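/- (Shen's maximal magnetic estimate.) Let d ≥ 3 and r ≥ 0. Assume A ∈ C^{r+2}(ℝ^d; ℝ^d), U ∈ C^{r+2}(ℝ^d; ℝ) with U ≥ 0, and that there is C > 0 such that for all x, Σ_{j<k} Σ_{|β|=r+1} |∂^β B_{jk}(x)| + Σ_{|β|=r+2} |∂^β U(x)| ≤ C m̌_{B,U}(x), where m̌_{B,U}(x) = Σ_{j<k} Σ_{|β|≤r} |∂^β B_{jk}(x)| + Σ_{|β|≤r+1} |∂^β U(x)| + 1. Then there is C' > 0 such that for all complex-valued u ∈ C_0^∞(ℝ^d), Σ_{1≤j,ℓ≤d} ‖ (D_{x_j} − A_j)(D_{x_ℓ} − A_ℓ) u ‖ ≤ C' ( ‖P_{A,U} u‖ + ‖u‖ ). -/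

import Mathlib

open MeasureTheory Real Filter

noncomputable section

/-- `ℝ^d` with the Euclidean structure. -/
abbrev Rd (d : ℕ) := EuclideanSpace ℝ (Fin d)

/-- Partial derivative `∂_{x_j}` of a complex-valued function. -/
def pdC {d : ℕ} (j : Fin d) (f : Rd d → ℂ) : Rd d → ℂ :=
  fun x => fderiv ℝ f x (EuclideanSpace.single j (1:ℝ))

/-- Partial derivative `∂_{x_j}` of a real-valued function. -/
def pdR {d : ℕ} (j : Fin d) (f : Rd d → ℝ) : Rd d → ℝ :=
  fun x => fderiv ℝ f x (EuclideanSpace.single j (1:ℝ))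

/-- Iterated partial derivative in the `j`-th direction. -/
def pdIter {d : ℕ} (j : Fin d) : ℕ → (Rd d → ℝ) → (Rd d → ℝ)
  | 0, f => f
  | n+1, f => pdR j (pdIter j n f)

/-- Multi-index partial derivative `∂^α`. -/
def pdMulti {d : ℕ} (α : Fin d → ℕ) (f : Rd d → ℝ) : Rd d → ℝ :=
  (List.finRange d).foldr (fun j g => pdIter j (α j) g) f

/-- The finite set of multi-indices `α` with `|α| = q`. -/
def mIdx (d q : ℕ) : Finset (Fin d → ℕ) := Finset.Nat.antidiagonalTuple d q

/-- The magnetic field `B_{jk} = ∂_j A_k - ∂_k A_j`. -/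
def magB {d : ℕ} (A : Fin d → Rd d → ℝ) (j k : Fin d) : Rd d → ℝ :=
  fun x => pdR j (A k) x - pdR k (A j) x

/-- The quantity `m̌_q(x)`. -/
def mq {d p : ℕ} (A : Fin d → Rd d → ℝ) (U : Fin p → Rd d → ℝ) (V : Rd d → ℝ) :
    ℕ → Rd d → ℝ
  | 0, x => ∑ ℓ, |U ℓ x|
  | q+1, x =>
      (∑ ℓ, ∑ α ∈ mIdx d (q+1), |pdMulti α (U ℓ) x|)
      + (∑ jk ∈ Finset.univ.filter (fun jk : Fin d × Fin d => jk.1 < jk.2),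
          ∑ α ∈ mIdx d q, |pdMulti α (magB A jk.1 jk.2) x|)
      + ∑ α ∈ mIdx d q, |pdMulti α V x|

/-- The quantity `m̌ʳ(x) = 1 + ∑_{q=0}^r m̌_q(x)`. -/
def mr {d p : ℕ} (A : Fin d → Rd d → ℝ) (U : Fin p → Rd d → ℝ) (V : Rd d → ℝ)
    (r : ℕ) (x : Rd d) : ℝ :=
  1 + ∑ q ∈ Finset.range (r+1), mq A U V q x

/-- The magnetic derivative `X_j u = (D_{x_j} - A_j) u`, `D_{x_j} = -i ∂_{x_j}`. -/
def Xop {d : ℕ} (A : Fin d → Rd d → ℝ) (j : Fin d) (u : Rd d → ℂ) : Rd d → ℂ :=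
  fun x => -Complex.I * pdC j u x - (A j x : ℂ) * u x

/-- The potential `W = ∑_ℓ U_ℓ² + iV`. -/
def Wfun {d p : ℕ} (U : Fin p → Rd d → ℝ) (V : Rd d → ℝ) (x : Rd d) : ℂ :=
  ((∑ ℓ, (U ℓ x)^2 : ℝ) : ℂ) + (V x : ℝ) * Complex.I

/-- The operator `P_{A,W} u = ∑_j X_j² u + W u` with `W = ∑_ℓ U_ℓ² + iV`. -/
def Pop {d p : ℕ} (A : Fin d → Rd d → ℝ) (U : Fin p → Rd d → ℝ) (V : Rd d → ℝ)
    (u : Rd d → ℂ) : Rd d → ℂ :=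
  fun x => (∑ j, Xop A j (Xop A j u) x) + Wfun U V x * u x

/-- The function `Φ(x,t)`. -/
def Phi {d p : ℕ} (A : Fin d → Rd d → ℝ) (U : Fin p → Rd d → ℝ) (V : Rd d → ℝ)
    (r : ℕ) (x : Rd d) (t : ℝ) : ℝ :=
  (∑ ℓ, ∑ q ∈ Finset.range (r+1), t^(q+1) * ∑ α ∈ mIdx d q, |pdMulti α (U ℓ) x|)
  + (∑ jk ∈ Finset.univ.filter (fun jk : Fin d × Fin d => jk.1 < jk.2),
      ∑ q ∈ Finset.range r, t^(q+2) * ∑ α ∈ mIdx d q, |pdMulti α (magB A jk.1 jk.2) x|)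
  + ∑ q ∈ Finset.range r, t^(q+2) * ∑ α ∈ mIdx d q, |pdMulti α V x|

/-- `R(x,μ) = sup { t ∈ [0,1] : Φ(x,t) ≤ μ }`. -/
def Rfun {d p : ℕ} (A : Fin d → Rd d → ℝ) (U : Fin p → Rd d → ℝ) (V : Rd d → ℝ)
    (r : ℕ) (x : Rd d) (μ : ℝ) : ℝ :=
  sSup {t : ℝ | t ∈ Set.Icc (0:ℝ) 1 ∧ Phi A U V r x t ≤ μ}



section calc1
variable {d : ℕ}

lemma pdR_add {f g : Rd d → ℝ} {x : Rd d} (j : Fin d) (hf : DifferentiableAt ℝ f x)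
    (hg : DifferentiableAt ℝ g x) :
    pdR j (fun y => f y + g y) x = pdR j f x + pdR j g x := by
  unfold pdR
  rw [fderiv_fun_add hf hg]; rfl

lemma pdR_sub {f g : Rd d → ℝ} {x : Rd d} (j : Fin d) (hf : DifferentiableAt ℝ f x)
    (hg : DifferentiableAt ℝ g x) :
    pdR j (fun y => f y - g y) x = pdR j f x - pdR j g x := by
  unfold pdR
  rw [fderiv_fun_sub hf hg]; rfl

lemma pdR_mul {f g : Rd d → ℝ} {x : Rd d} (j : Fin d) (hf : DifferentiableAt ℝ f x)
    (hg : DifferentiableAt ℝ g x) :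
    pdR j (fun y => f y * g y) x = f x * pdR j g x + g x * pdR j f x := by
  unfold pdR
  rw [fderiv_fun_mul hf hg]; simp

lemma pdR_pow {f : Rd d → ℝ} {x : Rd d} (j : Fin d) (n : ℕ) (hf : DifferentiableAt ℝ f x) :
    pdR j (fun y => f y ^ n) x = n * f x ^ (n-1) * pdR j f x := by
  unfold pdR
  rw [fderiv_fun_pow n hf]; simp [mul_assoc]

lemma pdR_sum {ι : Type*} (s : Finset ι) {f : ι → Rd d → ℝ} {x : Rd d} (j : Fin d)
    (hf : ∀ i ∈ s, DifferentiableAt ℝ (f i) x) :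
    pdR j (fun y => ∑ i ∈ s, f i y) x = ∑ i ∈ s, pdR j (f i) x := by
  unfold pdR
  rw [fderiv_fun_sum hf]; simp

lemma pdR_const (c : ℝ) (x : Rd d) (j : Fin d) : pdR j (fun _ => c) x = 0 := by
  unfold pdR; simp

lemma pdC_add {f g : Rd d → ℂ} {x : Rd d} (j : Fin d) (hf : DifferentiableAt ℝ f x)
    (hg : DifferentiableAt ℝ g x) :
    pdC j (fun y => f y + g y) x = pdC j f x + pdC j g x := by
  unfold pdC
  rw [fderiv_fun_add hf hg]; rfl

lemma pdC_sub {f g : Rd d → ℂ} {x : Rd d} (j : Fin d) (hf : DifferentiableAt ℝ f x)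
    (hg : DifferentiableAt ℝ g x) :
    pdC j (fun y => f y - g y) x = pdC j f x - pdC j g x := by
  unfold pdC
  rw [fderiv_fun_sub hf hg]; rfl

lemma pdC_mul {f g : Rd d → ℂ} {x : Rd d} (j : Fin d) (hf : DifferentiableAt ℝ f x)
    (hg : DifferentiableAt ℝ g x) :
    pdC j (fun y => f y * g y) x = f x * pdC j g x + g x * pdC j f x := by
  unfold pdC
  rw [fderiv_fun_mul hf hg]; simp

lemma pdC_const_mul {g : Rd d → ℂ} {x : Rd d} (j : Fin d) (c : ℂ)
    (hg : DifferentiableAt ℝ g x) :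
    pdC j (fun y => c * g y) x = c * pdC j g x := by
  unfold pdC
  rw [fderiv_const_mul hg]; simp

lemma pdC_ofReal {f : Rd d → ℝ} {x : Rd d} (j : Fin d) (hf : DifferentiableAt ℝ f x) :
    pdC j (fun y => (f y : ℂ)) x = (pdR j f x : ℂ) := by
  unfold pdC pdR
  have := (Complex.ofRealCLM.hasFDerivAt.comp x hf.hasFDerivAt).fderiv
  have h2 : (fun y => (f y : ℂ)) = Complex.ofRealCLM ∘ f := by ext; simp
  rw [h2, this]; simp

lemma pdR_re {f : Rd d → ℂ} {x : Rd d} (j : Fin d) (hf : DifferentiableAt ℝ f x) :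
    pdR j (fun y => (f y).re) x = (pdC j f x).re := by
  unfold pdC pdR
  have := (Complex.reCLM.hasFDerivAt.comp x hf.hasFDerivAt).fderiv
  have h2 : (fun y => (f y).re) = Complex.reCLM ∘ f := by ext; simp
  rw [h2, this]; simp

lemma pdR_im {f : Rd d → ℂ} {x : Rd d} (j : Fin d) (hf : DifferentiableAt ℝ f x) :
    pdR j (fun y => (f y).im) x = (pdC j f x).im := by
  unfold pdC pdR
  have := (Complex.imCLM.hasFDerivAt.comp x hf.hasFDerivAt).fderiv
  have h2 : (fun y => (f y).im) = Complex.imCLM ∘ f := by ext; simp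
  rw [h2, this]; simp

lemma diff_re {f : Rd d → ℂ} {x : Rd d} (hf : DifferentiableAt ℝ f x) :
    DifferentiableAt ℝ (fun y => (f y).re) x :=
  (Complex.reCLM.hasFDerivAt.comp x hf.hasFDerivAt).differentiableAt

lemma diff_im {f : Rd d → ℂ} {x : Rd d} (hf : DifferentiableAt ℝ f x) :
    DifferentiableAt ℝ (fun y => (f y).im) x :=
  (Complex.imCLM.hasFDerivAt.comp x hf.hasFDerivAt).differentiableAt

lemma diff_ofReal {f : Rd d → ℝ} {x : Rd d} (hf : DifferentiableAt ℝ f x) :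
    DifferentiableAt ℝ (fun y => (f y : ℂ)) x :=
  (Complex.ofRealCLM.hasFDerivAt.comp x hf.hasFDerivAt).differentiableAt

lemma contDiff_re {n : WithTop ℕ∞} {f : Rd d → ℂ} (hf : ContDiff ℝ n f) :
    ContDiff ℝ n (fun y => (f y).re) := Complex.reCLM.contDiff.comp hf

lemma contDiff_im {n : WithTop ℕ∞} {f : Rd d → ℂ} (hf : ContDiff ℝ n f) :
    ContDiff ℝ n (fun y => (f y).im) := Complex.imCLM.contDiff.comp hf

lemma contDiff_ofReal' {n : WithTop ℕ∞} {f : Rd d → ℝ} (hf : ContDiff ℝ n f) :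
    ContDiff ℝ n (fun y => (f y : ℂ)) := Complex.ofRealCLM.contDiff.comp hf

lemma pdC_contDiff {n m : WithTop ℕ∞} {f : Rd d → ℂ} (j : Fin d) (hf : ContDiff ℝ m f)
    (h : n + 1 ≤ m) : ContDiff ℝ n (pdC j f) :=
  (hf.fderiv_right h).clm_apply contDiff_const

lemma pdR_contDiff {n m : WithTop ℕ∞} {f : Rd d → ℝ} (j : Fin d) (hf : ContDiff ℝ m f)
    (h : n + 1 ≤ m) : ContDiff ℝ n (pdR j f) :=
  (hf.fderiv_right h).clm_apply contDiff_const

lemma fderiv_fderiv_comm {F : Type*} [NormedAddCommGroup F] [NormedSpace ℝ F]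
    {f : Rd d → F} (hf : ContDiff ℝ 2 f) (x v w : Rd d) :
    fderiv ℝ (fun y => fderiv ℝ f y v) x w = fderiv ℝ (fun y => fderiv ℝ f y w) x v := by
  have hd : DifferentiableAt ℝ (fderiv ℝ f) x :=
    ((hf.fderiv_right (m := 1) (by norm_num)).differentiable (by norm_num)) x
  have key : ∀ v, fderiv ℝ (fun y => fderiv ℝ f y v) x = (fderiv ℝ (fderiv ℝ f) x).flip v := by
    intro v
    rw [fderiv_clm_apply hd (differentiableAt_const _)]
    simp
  rw [key, key]
  have hs : IsSymmSndFDerivAt ℝ f x :=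
    hf.contDiffAt.isSymmSndFDerivAt (by simp)
  simpa using hs w v

lemma pdC_comm {f : Rd d → ℂ} (hf : ContDiff ℝ 2 f) (j k : Fin d) :
    pdC j (pdC k f) = pdC k (pdC j f) := by
  ext x; exact fderiv_fderiv_comm hf x _ _

lemma pdR_comm {f : Rd d → ℝ} (hf : ContDiff ℝ 2 f) (j k : Fin d) :
    pdR j (pdR k f) = pdR k (pdR j f) := by
  ext x; exact fderiv_fderiv_comm hf x _ _

lemma pdR_hasCompactSupport {f : Rd d → ℝ} (j : Fin d) (hf : HasCompactSupport f) :
    HasCompactSupport (pdR j f) := hf.fderiv_apply ℝ _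

lemma pdC_hasCompactSupport {f : Rd d → ℂ} (j : Fin d) (hf : HasCompactSupport f) :
    HasCompactSupport (pdC j f) := hf.fderiv_apply ℝ _

lemma integral_pdR_eq_zero {φ : Rd d → ℝ} (hφ : ContDiff ℝ 1 φ) (hc : HasCompactSupport φ)
    (j : Fin d) : ∫ x, pdR j φ x = 0 := by
  have hcont : Continuous (pdR j φ) :=
    (pdR_contDiff (n := 0) j hφ (by norm_num)).continuous
  have hi : Integrable (pdR j φ) :=
    hcont.integrable_of_hasCompactSupport (pdR_hasCompactSupport j hc)
  have hi2 : Integrable φ := hφ.continuous.integrable_of_hasCompactSupport hc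
  have := integral_mul_fderiv_eq_neg_fderiv_mul_of_integrable (𝕜 := ℝ) (μ := volume)
    (f := fun _ : Rd d => (1:ℝ)) (g := φ) (v := EuclideanSpace.single j (1:ℝ))
    (by simp) (by simp only [one_mul]; exact hi) (by simpa using hi2)
    (fun x _ => differentiableAt_const _) (fun x _ => (hφ.differentiable (by norm_num)) x)
  simpa [pdR] using this

/-- Real inner product on `ℂ`. -/
def rip (a b : ℂ) : ℝ := a.re * b.re + a.im * b.im

lemma rip_self (a : ℂ) : rip a a = ‖a‖^2 := by
  rw [← Complex.normSq_eq_norm_sq, Complex.normSq_apply]; rfl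

lemma rip_comm (a b : ℂ) : rip a b = rip b a := by unfold rip; ring

lemma abs_rip_le (a b : ℂ) : |rip a b| ≤ ‖a‖ * ‖b‖ := by
  apply abs_le_of_sq_le_sq _ (by positivity)
  rw [mul_pow, ← Complex.normSq_eq_norm_sq, ← Complex.normSq_eq_norm_sq, Complex.normSq_apply,
    Complex.normSq_apply]
  unfold rip
  nlinarith [sq_nonneg (a.re * b.im - a.im * b.re)]

lemma rip_le (a b : ℂ) : rip a b ≤ ‖a‖ * ‖b‖ := (le_abs_self _).trans (abs_rip_le a b)

lemma rip_add_left (a b c : ℂ) : rip (a + b) c = rip a c + rip b c := by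
  simp [rip]; ring

lemma rip_sub_left (a b c : ℂ) : rip (a - b) c = rip a c - rip b c := by
  simp [rip]; ring

lemma rip_add_right (a b c : ℂ) : rip a (b + c) = rip a b + rip a c := by
  simp [rip]; ring

lemma rip_sum_left {ι : Type*} (s : Finset ι) (f : ι → ℂ) (c : ℂ) :
    rip (∑ i ∈ s, f i) c = ∑ i ∈ s, rip (f i) c := by
  simp [rip, Finset.sum_add_distrib, Finset.sum_mul]

lemma rip_sum_right {ι : Type*} (s : Finset ι) (f : ι → ℂ) (c : ℂ) :
    rip c (∑ i ∈ s, f i) = ∑ i ∈ s, rip c (f i) := by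
  simp [rip, Finset.sum_add_distrib, Finset.mul_sum]

lemma rip_continuous {f g : Rd d → ℂ} (hf : Continuous f) (hg : Continuous g) :
    Continuous (fun x => rip (f x) (g x)) := by
  unfold rip; fun_prop

lemma Xop_contDiff {n : ℕ} {A : Fin d → Rd d → ℝ} {j : Fin d} {u : Rd d → ℂ}
    (hA : ContDiff ℝ n (A j)) (hu : ContDiff ℝ (n+1 : ℕ) u) : ContDiff ℝ n (Xop A j u) := by
  unfold Xop
  have h1 : ContDiff ℝ n (pdC j u) := pdC_contDiff j hu (by norm_cast)
  have h2 : ContDiff ℝ n u := hu.of_le (by norm_cast; omega)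
  exact (contDiff_const.mul h1).sub ((contDiff_ofReal' hA).mul h2)

lemma Xop_hasCompactSupport {A : Fin d → Rd d → ℝ} {j : Fin d} {u : Rd d → ℂ}
    (hu : HasCompactSupport u) : HasCompactSupport (Xop A j u) := by
  unfold Xop
  have h1 := pdC_hasCompactSupport j hu
  have a1 : HasCompactSupport (fun x => -Complex.I * pdC j u x) := h1.mul_left
  have a2 : HasCompactSupport (fun x => (A j x : ℂ) * u x) := hu.mul_left
  exact a1.sub a2

/-- Symmetry of the magnetic derivative. -/
lemma Xop_symm {A : Fin d → Rd d → ℝ} (j : Fin d) (hA : Continuous (A j)) {v w : Rd d → ℂ}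
    (hv : ContDiff ℝ 1 v) (hw : ContDiff ℝ 1 w) (hc : HasCompactSupport v) :
    ∫ x, rip (Xop A j v x) (w x) = ∫ x, rip (v x) (Xop A j w x) := by
  have dv : ∀ x, DifferentiableAt ℝ v x := hv.differentiable (by norm_num)
  have dw : ∀ x, DifferentiableAt ℝ w x := hw.differentiable (by norm_num)
  have hXv : Continuous (Xop A j v) := by
    have h1 : Continuous (pdC j v) := (pdC_contDiff (n := 0) j hv (by norm_num)).continuous
    have := hv.continuous
    unfold Xop; fun_prop
  have hXw : Continuous (Xop A j w) := by
    have h1 : Continuous (pdC j w) := (pdC_contDiff (n := 0) j hw (by norm_num)).continuous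
    have := hw.continuous
    unfold Xop; fun_prop
  have i1 : Integrable (fun x => rip (Xop A j v x) (w x)) := by
    apply (rip_continuous hXv hw.continuous).integrable_of_hasCompactSupport
    apply (Xop_hasCompactSupport (A := A) (j := j) hc).mono
    intro x hx
    simp only [Function.mem_support] at hx ⊢
    contrapose! hx; simp [hx, rip]
  have i2 : Integrable (fun x => rip (v x) (Xop A j w x)) := by
    apply (rip_continuous hv.continuous hXw).integrable_of_hasCompactSupport
    apply hc.mono
    intro x hx
    simp only [Function.mem_support] at hx ⊢
    contrapose! hx; simp [hx, rip]
  set φ : Rd d → ℝ := fun x => (v x).im * (w x).re - (v x).re * (w x).im with hφ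
  have cφ : ContDiff ℝ 1 φ :=
    ((contDiff_im hv).mul (contDiff_re hw)).sub ((contDiff_re hv).mul (contDiff_im hw))
  have sφ : HasCompactSupport φ := by
    apply hc.mono
    intro x hx
    simp only [Function.mem_support] at hx ⊢
    contrapose! hx; simp [hφ, hx]
  have h0 := integral_pdR_eq_zero cφ sφ j
  have hp : ∀ x, pdR j φ x = rip (Xop A j v x) (w x) - rip (v x) (Xop A j w x) := by
    intro x
    rw [hφ, pdR_sub j ((diff_im (dv x)).fun_mul (diff_re (dw x)))
      ((diff_re (dv x)).fun_mul (diff_im (dw x))), pdR_mul j (diff_im (dv x)) (diff_re (dw x)),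
      pdR_mul j (diff_re (dv x)) (diff_im (dw x)), pdR_re j (dv x), pdR_im j (dv x),
      pdR_re j (dw x), pdR_im j (dw x)]
    simp [rip, Xop]; ring
  simp_rw [hp] at h0
  rw [integral_sub i1 i2] at h0
  linarith

/-- Commutator identity. -/
lemma Xop_commutator {A : Fin d → Rd d → ℝ} (hA : ∀ j, ContDiff ℝ 1 (A j)) {u : Rd d → ℂ}
    (hu : ContDiff ℝ 2 u) (j k : Fin d) (x : Rd d) :
    Xop A j (Xop A k u) x = Xop A k (Xop A j u) x + Complex.I * (magB A j k x : ℂ) * u x := by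
  have du : DifferentiableAt ℝ u x := hu.differentiable (by norm_num) x
  have dA : ∀ j, DifferentiableAt ℝ (fun y => (A j y : ℂ)) x := fun j =>
    diff_ofReal ((hA j).differentiable (by norm_num) x)
  have dp : ∀ j, DifferentiableAt ℝ (pdC j u) x := fun j =>
    (pdC_contDiff (n := 1) j hu (by norm_num)).differentiable (by norm_num) x
  have key : ∀ j k, pdC j (Xop A k u) x = -Complex.I * pdC j (pdC k u) x -
      ((A k x : ℂ) * pdC j u x + u x * (pdR j (A k) x : ℂ)) := by
    intro j k
    unfold Xop
    rw [pdC_sub j ((dp k).const_mul _) ((dA k).fun_mul du), pdC_const_mul j _ (dp k),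
      pdC_mul j (dA k) du, pdC_ofReal j ((hA k).differentiable (by norm_num) x)]
  have e : ∀ j k, Xop A j (Xop A k u) x = -Complex.I * pdC j (Xop A k u) x
    - (A j x : ℂ) * (-Complex.I * pdC k u x - (A k x : ℂ) * u x) := fun j k => rfl
  rw [e, e, key, key, pdC_comm hu j k]
  simp only [magB, Complex.ofReal_sub]
  ring

lemma Xop_mul {A : Fin d → Rd d → ℝ} {f : Rd d → ℝ} {u : Rd d → ℂ} {x : Rd d} (j : Fin d) (c : ℂ)
    (hf : DifferentiableAt ℝ f x) (hu : DifferentiableAt ℝ u x) :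
    Xop A j (fun y => c * ((f y : ℂ) * u y)) x =
      c * ((f x : ℂ) * Xop A j u x - Complex.I * (pdR j f x : ℂ) * u x) := by
  unfold Xop
  rw [pdC_const_mul j c ((diff_ofReal hf).fun_mul hu), pdC_mul j (diff_ofReal hf) hu, pdC_ofReal j hf]
  ring

/-- diamagnetic identity -/
lemma pdR_normSq {A : Fin d → Rd d → ℝ} {u : Rd d → ℂ} {x : Rd d} (j : Fin d)
    (hu : DifferentiableAt ℝ u x) :
    |pdR j (fun y => ‖u y‖^2) x| ≤ 2 * (‖u x‖ * ‖Xop A j u x‖) := by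
  have h : (fun y => ‖u y‖^2) = fun y => (u y).re * (u y).re + (u y).im * (u y).im := by
    ext y; rw [← rip_self]; rfl
  have e : pdR j (fun y => ‖u y‖^2) x = 2 * rip (u x) (Complex.I * Xop A j u x) := by
    rw [h, pdR_add j ((diff_re hu).fun_mul (diff_re hu)) ((diff_im hu).fun_mul (diff_im hu)),
      pdR_mul j (diff_re hu) (diff_re hu), pdR_mul j (diff_im hu) (diff_im hu),
      pdR_re j hu, pdR_im j hu]
    simp [rip, Xop]; ring
  rw [e, abs_mul]
  have := abs_rip_le (u x) (Complex.I * Xop A j u x)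
  simp at this ⊢
  linarith

lemma contDiff_normSq' {n : WithTop ℕ∞} {u : Rd d → ℂ} (hu : ContDiff ℝ n u) :
    ContDiff ℝ n (fun y => ‖u y‖^2) := hu.norm_sq ℝ

end calc1

section core
variable {d : ℕ}

lemma u_zero {u : Rd d → ℂ} {x : Rd d} (hx : x ∉ tsupport u) : u x = 0 :=
  image_eq_zero_of_notMem_tsupport hx

lemma Xop_zero {A : Fin d → Rd d → ℝ} {j : Fin d} {u : Rd d → ℂ} {x : Rd d}
    (hx : x ∉ tsupport u) : Xop A j u x = 0 := by
  have h : fderiv ℝ u x = 0 := by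
    by_contra hne
    exact hx (support_fderiv_subset ℝ hne)
  simp [Xop, pdC, h, u_zero hx]

lemma Xop_tsupport {A : Fin d → Rd d → ℝ} {j : Fin d} {u : Rd d → ℂ} :
    tsupport (Xop A j u) ⊆ tsupport u := by
  apply closure_minimal _ (isClosed_tsupport u)
  intro x hx
  by_contra h
  exact hx (Xop_zero h)

lemma XXop_zero {A : Fin d → Rd d → ℝ} {j k : Fin d} {u : Rd d → ℂ} {x : Rd d}
    (hx : x ∉ tsupport u) : Xop A j (Xop A k u) x = 0 :=
  Xop_zero (fun h => hx (Xop_tsupport h))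

lemma integrable_of_vanish {F : Rd d → ℝ} {u : Rd d → ℂ} (hc : HasCompactSupport u)
    (hF : Continuous F) (h0 : ∀ x, x ∉ tsupport u → F x = 0) : Integrable F := by
  apply hF.integrable_of_hasCompactSupport
  apply hc.mono'
  intro x hx
  by_contra h
  exact hx (h0 x h)

structure Pkg {ι : Type} [Fintype ι] (A : Fin d → Rd d → ℝ) (U : Rd d → ℝ)
    (chain : ι → ι → Fin d → Prop) (isB : ι → Fin d → Fin d → Prop) (isU : ι → Prop)
    (K μ : ℝ) (m : Rd d → ℝ) (b : ι → Rd d → ℝ) : Prop where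
  m1 : ∀ x, 1 ≤ m x
  mC : ContDiff ℝ 1 m
  bC : ∀ i, ContDiff ℝ 1 (b i)
  b1 : ∀ i x, |b i x| ≤ 1
  dm : ∀ j x, |pdR j m x| ≤ K * m x ^ 2
  db : ∀ i j x, |pdR j (b i) x| ≤ K * m x
  baseB : ∀ i j k, isB i j k → ∀ x, magB A j k x = μ * (b i x * m x ^ 2)
  baseU : ∀ i, isU i → ∀ x, U x = μ * (b i x * m x ^ 2)
  chn : ∀ i i' j, chain i i' j → ∀ x, |b i' x * m x - pdR j (b i) x| ≤ K * |b i x| * m x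
  cover : ∀ x, m x ^ 4 ≤ m x ^ 2 + ∑ i, b i x ^ 2 * m x ^ 4
  Ble : ∀ j k x, |magB A j k x| ≤ μ * m x ^ 2
  Ule : ∀ x, U x ≤ μ * m x ^ 2

/-- The energy density. -/
def eD (A : Fin d → Rd d → ℝ) (U m : Rd d → ℝ) (u : Rd d → ℂ) (x : Rd d) : ℝ :=
  ∑ j, (m x * ‖Xop A j u x‖)^2 + (m x ^ 2 * ‖u x‖)^2 + U x * (m x * ‖u x‖)^2

variable {A : Fin d → Rd d → ℝ} {U m : Rd d → ℝ} {u : Rd d → ℂ}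

lemma eD_X (hU : ∀ x, 0 ≤ U x) (j : Fin d) (x : Rd d) :
    (m x * ‖Xop A j u x‖)^2 ≤ eD A U m u x := by
  have h1 : (m x * ‖Xop A j u x‖)^2 ≤ ∑ j, (m x * ‖Xop A j u x‖)^2 :=
    Finset.single_le_sum (f := fun j => (m x * ‖Xop A j u x‖)^2)
      (fun i _ => sq_nonneg _) (Finset.mem_univ j)
  have h2 : 0 ≤ U x * (m x * ‖u x‖)^2 := mul_nonneg (hU x) (sq_nonneg _)
  unfold eD
  nlinarith [sq_nonneg (m x ^ 2 * ‖u x‖)]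

lemma eD_u (hU : ∀ x, 0 ≤ U x) (x : Rd d) :
    (m x ^ 2 * ‖u x‖)^2 ≤ eD A U m u x := by
  have h1 : 0 ≤ ∑ j, (m x * ‖Xop A j u x‖)^2 := Finset.sum_nonneg (fun i _ => sq_nonneg _)
  have h2 : 0 ≤ U x * (m x * ‖u x‖)^2 := mul_nonneg (hU x) (sq_nonneg _)
  unfold eD
  linarith

lemma eD_U (x : Rd d) :
    U x * (m x * ‖u x‖)^2 ≤ eD A U m u x := by
  have h1 : 0 ≤ ∑ j, (m x * ‖Xop A j u x‖)^2 := Finset.sum_nonneg (fun i _ => sq_nonneg _)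
  unfold eD
  nlinarith [sq_nonneg (m x ^ 2 * ‖u x‖)]

lemma X1 (hA : ∀ j, ContDiff ℝ 2 (A j)) (hu : ContDiff ℝ (⊤ : ℕ∞) u) (j : Fin d) :
    ContDiff ℝ 2 (Xop A j u) :=
  Xop_contDiff (n := 2) (hA j) (contDiff_infty.mp hu 3)

lemma X2 (hA : ∀ j, ContDiff ℝ 2 (A j)) (hu : ContDiff ℝ (⊤ : ℕ∞) u) (j k : Fin d) :
    ContDiff ℝ 1 (Xop A j (Xop A k u)) :=
  Xop_contDiff (n := 1) ((hA j).of_le (by norm_num)) ((X1 hA hu k).of_le (by norm_num))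

lemma eD_cont (hA : ∀ j, ContDiff ℝ 2 (A j)) (hU : Continuous U) (hm : Continuous m)
    (hu : ContDiff ℝ (⊤ : ℕ∞) u) : Continuous (eD A U m u) := by
  have h := fun j => (X1 hA hu j).continuous
  have h2 := hu.continuous
  unfold eD
  fun_prop

lemma eD_int (hA : ∀ j, ContDiff ℝ 2 (A j)) (hU : Continuous U) (hm : Continuous m)
    (hu : ContDiff ℝ (⊤ : ℕ∞) u) (hc : HasCompactSupport u) : Integrable (eD A U m u) := by
  apply integrable_of_vanish hc (eD_cont hA hU hm hu)
  intro x hx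
  simp [eD, u_zero hx, Xop_zero hx]

variable {ι : Type} [Fintype ι] {chain : ι → ι → Fin d → Prop} {isB : ι → Fin d → Fin d → Prop}
  {isU : ι → Prop} {K μ : ℝ} {b : ι → Rd d → ℝ}

lemma step_B (hA : ∀ j, ContDiff ℝ 2 (A j)) (hU : Continuous U) (hU0 : ∀ x, 0 ≤ U x)
    (hu : ContDiff ℝ (⊤ : ℕ∞) u) (hc : HasCompactSupport u) (hK : 0 ≤ K)
    (P : Pkg A U chain isB isU K μ m b) (i : ι) (j k : Fin d) (hi : isB i j k) :
    μ * ∫ x, (b i x * (m x ^ 2 * ‖u x‖))^2 ≤ (2 + 6 * K) * ∫ x, eD A U m u x := by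
  have hA1 : ∀ j, ContDiff ℝ 1 (A j) := fun j => (hA j).of_le (by norm_num)
  have hu2 : ContDiff ℝ 2 u := contDiff_infty.mp hu 2
  have hu1 : ContDiff ℝ 1 u := hu.of_le (by exact_mod_cast le_top)
  have du : ∀ x, DifferentiableAt ℝ u x := hu1.differentiable (by norm_num)
  have dm : ∀ x, DifferentiableAt ℝ m x := P.mC.differentiable (by norm_num)
  have db : ∀ x, DifferentiableAt ℝ (b i) x := (P.bC i).differentiable (by norm_num)
  set f : Rd d → ℝ := fun x => b i x * m x ^ 2 with hf
  have cf : ContDiff ℝ 1 f := (P.bC i).mul (P.mC.pow 2)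
  have df : ∀ x, DifferentiableAt ℝ f x := cf.differentiable (by norm_num)
  set w : Rd d → ℂ := fun x => Complex.I * ((f x : ℂ) * u x) with hw
  have cw : ContDiff ℝ 1 w := contDiff_const.mul ((contDiff_ofReal' cf).mul hu1)
  have fle : ∀ x, |f x| ≤ m x ^ 2 := by
    intro x
    have := P.b1 i x
    rw [hf]; simp only [abs_mul, abs_pow, sq_abs]
    nlinarith [sq_nonneg (m x)]
  have dfle : ∀ j x, |pdR j f x| ≤ 3 * K * m x ^ 3 := by
    intro j x
    have m1 := P.m1 x
    have e : pdR j f x = b i x * (2 * m x * pdR j m x) + m x ^ 2 * pdR j (b i) x := by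
      rw [hf, pdR_mul j (db x) ((dm x).fun_pow 2), pdR_pow j 2 (dm x)]
      simp
    rw [e]
    calc _ ≤ |b i x * (2 * m x * pdR j m x)| + |m x ^ 2 * pdR j (b i) x| := abs_add_le _ _
      _ = |b i x| * (2 * m x * |pdR j m x|) + m x ^ 2 * |pdR j (b i) x| := by
        simp only [abs_mul, abs_pow, abs_two, abs_of_pos (show 0 < m x by linarith)]
      _ ≤ 1 * (2 * m x * (K * m x ^ 2)) + m x ^ 2 * (K * m x) := by
        gcongr
        · exact P.b1 i x
        · exact P.dm j x
        · exact P.db i j x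
      _ = _ := by ring
  have hX1 := fun j => (X1 hA hu j)
  have hX2 := fun j k => (X2 hA hu j k)
  have Xw : ∀ j x, ‖Xop A j w x‖ ≤ m x ^ 2 * ‖Xop A j u x‖ + 3 * K * m x ^ 3 * ‖u x‖ := by
    intro j x
    rw [hw, Xop_mul j Complex.I (df x) (du x)]
    rw [norm_mul, Complex.norm_I, one_mul]
    refine (norm_sub_le _ _).trans ?_
    simp only [norm_mul, Complex.norm_real, Complex.norm_I, one_mul, Real.norm_eq_abs]
    gcongr
    · exact fle x
    · exact dfle j x
  have cX : ∀ j, Continuous (Xop A j w) := fun j => by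
    have h1 : Continuous (pdC j w) := (pdC_contDiff (n := 0) j cw (by norm_num)).continuous
    have := cw.continuous
    have := (hA j).continuous
    unfold Xop; fun_prop
  have s1 : ∀ j k, ∫ x, rip (Xop A j (Xop A k u) x) (w x) = ∫ x, rip (Xop A k u x) (Xop A j w x) :=
    fun j k => Xop_symm j (hA j).continuous ((hX1 k).of_le (by norm_num)) cw
      (Xop_hasCompactSupport hc)
  have i1 : ∀ j k, Integrable (fun x => rip (Xop A j (Xop A k u) x) (w x)) := fun j k =>
    integrable_of_vanish hc (rip_continuous (hX2 j k).continuous cw.continuous)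
      (fun x hx => by simp [rip, XXop_zero hx])
  have i2 : ∀ j k, Integrable (fun x => rip (Xop A k u x) (Xop A j w x)) := fun j k =>
    integrable_of_vanish hc (rip_continuous (hX1 k).continuous (cX j))
      (fun x hx => by simp [rip, Xop_zero hx])
  have main : μ * ∫ x, (b i x * (m x ^ 2 * ‖u x‖))^2 =
      ∫ x, (rip (Xop A k u x) (Xop A j w x) - rip (Xop A j u x) (Xop A k w x)) := by
    rw [integral_sub (i2 j k) (i2 k j), ← s1, ← s1, ← integral_sub (i1 j k) (i1 k j),
      ← integral_const_mul]
    congr 1; ext x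
    rw [Xop_commutator hA1 hu2 j k x, rip_add_left, add_sub_cancel_left, P.baseB i j k hi x]
    have : ‖u x‖^2 = (u x).re * (u x).re + (u x).im * (u x).im := by rw [← rip_self]; rfl
    rw [mul_pow, mul_pow, this]
    simp only [hw, hf, rip, Complex.mul_re, Complex.mul_im, Complex.I_re, Complex.I_im,
      Complex.ofReal_re, Complex.ofReal_im]
    ring
  rw [main, ← integral_const_mul]
  have i3 : Integrable (fun x => rip (Xop A k u x) (Xop A j w x) -
      rip (Xop A j u x) (Xop A k w x)) := (i2 j k).sub (i2 k j)
  apply integral_mono i3 ((eD_int hA hU P.mC.continuous hu hc).const_mul _)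
  intro x
  have m1 := P.m1 x
  have a1 := (rip_le (Xop A k u x) (Xop A j w x)).trans
    (mul_le_mul_of_nonneg_left (Xw j x) (norm_nonneg _))
  have a2 := (neg_le_of_abs_le (abs_rip_le (Xop A j u x) (Xop A k w x)))
  have a3 := mul_le_mul_of_nonneg_left (Xw k x) (norm_nonneg (Xop A j u x))
  have b1 := eD_X (A := A) (m := m) (u := u) hU0 j x
  have b2 := eD_X (A := A) (m := m) (u := u) hU0 k x
  have b3 := eD_u (A := A) (m := m) (u := u) hU0 x
  simp only
  set p := m x * ‖Xop A j u x‖ with hp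
  set q := m x * ‖Xop A k u x‖ with hq
  set t := m x ^ 2 * ‖u x‖ with ht
  have c1 : rip (Xop A k u x) (Xop A j w x) ≤ q * p + 3 * K * (q * t) := by
    refine a1.trans (le_of_eq ?_); rw [hp, hq, ht]; ring
  have c2 : -rip (Xop A j u x) (Xop A k w x) ≤ p * q + 3 * K * (p * t) := by
    refine (neg_le.mp a2).trans (a3.trans (le_of_eq ?_)); rw [hp, hq, ht]; ring
  have d1 : q * t ≤ eD A U m u x := by nlinarith [sq_nonneg (q - t)]
  have d2 : p * t ≤ eD A U m u x := by nlinarith [sq_nonneg (p - t)]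
  have d3 : p * q ≤ eD A U m u x := by nlinarith [sq_nonneg (p - q)]
  nlinarith [mul_le_mul_of_nonneg_left d1 hK, mul_le_mul_of_nonneg_left d2 hK]

lemma step_U (hA : ∀ j, ContDiff ℝ 2 (A j)) (hU : Continuous U) (hU0 : ∀ x, 0 ≤ U x)
    (hu : ContDiff ℝ (⊤ : ℕ∞) u) (hc : HasCompactSupport u) (hμ : 1 ≤ μ)
    (P : Pkg A U chain isB isU K μ m b) (i : ι) (hi : isU i) :
    μ * ∫ x, (b i x * (m x ^ 2 * ‖u x‖))^2 ≤ ∫ x, eD A U m u x := by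
  rw [← integral_const_mul]
  have cm := P.mC.continuous
  have cb := (P.bC i).continuous
  have cu := hu.continuous
  refine integral_mono ?_ (eD_int hA hU P.mC.continuous hu hc) ?_
  · apply integrable_of_vanish hc (by fun_prop)
    intro x hx; simp [u_zero hx]
  intro x
  simp only
  refine le_trans ?_ (eD_U (A := A) (U := U) (m := m) (u := u) x)
  have hb := P.b1 i x
  have hUx := P.baseU i hi x
  have h0 := hU0 x
  have m1 := P.m1 x
  have b0 : 0 ≤ b i x := by
    by_contra hneg
    push Not at hneg
    have : 0 < μ * m x ^ 2 := by positivity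
    nlinarith
  have b1 : b i x ≤ 1 := (abs_le.mp hb).2
  rw [hUx]
  have : 0 ≤ μ * (m x ^ 2 * ‖u x‖)^2 := by positivity
  have h3 : b i x ^ 2 ≤ b i x := by nlinarith
  calc μ * (b i x * (m x ^ 2 * ‖u x‖)) ^ 2 = b i x ^ 2 * (μ * (m x ^ 2 * ‖u x‖)^2) := by ring
    _ ≤ b i x * (μ * (m x ^ 2 * ‖u x‖)^2) := mul_le_mul_of_nonneg_right h3 this
    _ = _ := by ring

lemma step_chain (hA : ∀ j, ContDiff ℝ 2 (A j)) (hU : Continuous U) (hU0 : ∀ x, 0 ≤ U x)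
    (hu : ContDiff ℝ (⊤ : ℕ∞) u) (hc : HasCompactSupport u) (hK : 0 ≤ K)
    (P : Pkg A U chain isB isU K μ m b) (i i' : ι) (j : Fin d) (hi : chain i i' j)
    (s : ℝ) (hs : 0 < s) :
    ∫ x, (b i' x * (m x ^ 2 * ‖u x‖))^2 ≤
      s * (∫ x, (b i x * (m x ^ 2 * ‖u x‖))^2) + (50 * K^2 + 8) / (4 * s) * ∫ x, eD A U m u x := by
  have hu1 : ContDiff ℝ 1 u := hu.of_le (by exact_mod_cast le_top)
  have du : ∀ x, DifferentiableAt ℝ u x := hu1.differentiable (by norm_num)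
  have dm : ∀ x, DifferentiableAt ℝ m x := P.mC.differentiable (by norm_num)
  have db : ∀ i x, DifferentiableAt ℝ (b i) x := fun i => (P.bC i).differentiable (by norm_num)
  have cm := P.mC.continuous
  have cb := fun i => (P.bC i).continuous
  have cu := hu.continuous
  set ψ : Rd d → ℝ := fun x => b i' x * m x ^ 3 * ‖u x‖^2 with hψ
  have cψ : ContDiff ℝ 1 ψ := ((P.bC i').mul (P.mC.pow 3)).mul (contDiff_normSq' hu1)
  have dψ : ∀ x, DifferentiableAt ℝ ψ x := cψ.differentiable (by norm_num)
  have dN : ∀ x, DifferentiableAt ℝ (fun x => ‖u x‖^2) x :=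
    (contDiff_normSq' hu1).differentiable (by norm_num)
  set φ : Rd d → ℝ := fun x => b i x * ψ x with hφ
  have cφ : ContDiff ℝ 1 φ := (P.bC i).mul cψ
  have sφ : HasCompactSupport φ := by
    apply hc.mono
    intro x hx
    simp only [Function.mem_support] at hx ⊢
    contrapose! hx; simp [hφ, hψ, hx]
  have z := integral_pdR_eq_zero cφ sφ j
  have iφ : Integrable (pdR j φ) :=
    (pdR_contDiff (n := 0) j cφ (by norm_num)).continuous.integrable_of_hasCompactSupport
      (pdR_hasCompactSupport j sφ)
  have ib : ∀ i, Integrable (fun x => (b i x * (m x ^ 2 * ‖u x‖))^2) := fun i => by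
    apply integrable_of_vanish hc (by have := cb i; fun_prop)
    intro x hx; simp [u_zero hx]
  have ie := eD_int hA hU P.mC.continuous hu hc
  have hle : ∫ x, (b i' x * (m x ^ 2 * ‖u x‖))^2 ≤ ∫ x, (pdR j φ x +
      (s * (b i x * (m x ^ 2 * ‖u x‖))^2 + (50 * K^2 + 8) / (4 * s) * eD A U m u x)) := by
    apply integral_mono (ib i') (iφ.fun_add (((ib i).const_mul _).fun_add (ie.const_mul _)))
    intro x
    simp only
    have m1 := P.m1 x
    have m0 : 0 < m x := by linarith
    have e1 : pdR j φ x = b i x * pdR j ψ x + ψ x * pdR j (b i) x := pdR_mul j (db i x) (dψ x)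
    have e2 : pdR j ψ x = b i' x * m x ^ 3 * pdR j (fun x => ‖u x‖^2) x +
        ‖u x‖^2 * (b i' x * (3 * m x ^ 2 * pdR j m x) + m x ^ 3 * pdR j (b i') x) := by
      rw [hψ, pdR_mul j ((db i' x).fun_mul ((dm x).fun_pow 3)) (dN x),
        pdR_mul j (db i' x) ((dm x).fun_pow 3), pdR_pow j 3 (dm x)]
      simp
    have k1 := P.b1 i' x
    have hdψ : |pdR j ψ x| ≤ 2 * (m x ^ 2 * ‖u x‖) * (m x * ‖Xop A j u x‖) +
        4 * K * (m x ^ 2 * ‖u x‖)^2 := by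
      rw [e2]
      calc _ ≤ |b i' x * m x ^ 3 * pdR j (fun x => ‖u x‖^2) x| +
            |‖u x‖^2 * (b i' x * (3 * m x ^ 2 * pdR j m x) + m x ^ 3 * pdR j (b i') x)| :=
            abs_add_le _ _
        _ ≤ |b i' x * m x ^ 3 * pdR j (fun x => ‖u x‖^2) x| +
            (‖u x‖^2 * (|b i' x * (3 * m x ^ 2 * pdR j m x)| + |m x ^ 3 * pdR j (b i') x|)) := by
            gcongr
            rw [abs_mul, abs_of_nonneg (sq_nonneg ‖u x‖)]
            gcongr
            exact abs_add_le _ _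
        _ = |b i' x| * m x ^ 3 * |pdR j (fun x => ‖u x‖^2) x| +
            (‖u x‖^2 * (|b i' x| * (3 * m x ^ 2 * |pdR j m x|) + m x ^ 3 * |pdR j (b i') x|)) := by
            simp only [abs_mul, abs_pow, abs_of_pos m0, abs_of_pos (show (0:ℝ) < 3 by norm_num)]
        _ ≤ 1 * m x ^ 3 * (2 * (‖u x‖ * ‖Xop A j u x‖)) +
            (‖u x‖^2 * (1 * (3 * m x ^ 2 * (K * m x ^ 2)) + m x ^ 3 * (K * m x))) := by
            gcongr
            · exact pdR_normSq j (du x)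
            · exact P.dm j x
            · exact P.db i' j x
        _ = _ := by ring
    have hch := P.chn i i' j hi x
    have q1 := eD_X (A := A) (m := m) (u := u) hU0 j x
    have q3 := eD_u (A := A) (m := m) (u := u) hU0 x
    set p := m x * ‖Xop A j u x‖ with hp
    set t := m x ^ 2 * ‖u x‖ with ht
    have t0 : 0 ≤ t := by positivity
    have p0 : 0 ≤ p := by positivity
    have hψle : |ψ x| * m x ≤ t ^ 2 := by
      have : |ψ x| * m x = |b i' x| * t^2 := by
        rw [hψ, ht]; simp only [abs_mul, abs_pow, abs_of_pos m0, abs_norm]; ring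
      rw [this]; nlinarith [sq_nonneg t]
    have f1 : (b i' x * t)^2 = ψ x * (b i' x * m x) := by rw [hψ, ht]; ring
    have f2 : ψ x * (b i' x * m x - pdR j (b i) x) ≤ K * |b i x| * t^2 := by
      calc _ ≤ |ψ x * (b i' x * m x - pdR j (b i) x)| := le_abs_self _
        _ = |ψ x| * |b i' x * m x - pdR j (b i) x| := abs_mul _ _
        _ ≤ |ψ x| * (K * |b i x| * m x) := by gcongr
        _ = K * |b i x| * (|ψ x| * m x) := by ring
        _ ≤ _ := by gcongr
    have f3 : -(b i x * pdR j ψ x) ≤ |b i x| * (2 * t * p + 4 * K * t^2) := by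
      calc _ ≤ |b i x * pdR j ψ x| := neg_le_abs _
        _ = |b i x| * |pdR j ψ x| := abs_mul _ _
        _ ≤ _ := by gcongr
    have f4 : (b i' x * t)^2 ≤ pdR j φ x + (|b i x| * t) * (2 * p + 5 * K * t) := by
      rw [f1, e1]; nlinarith
    have f5 : (|b i x| * t) * (2 * p + 5 * K * t) ≤
        s * (b i x * t)^2 + (2 * p + 5 * K * t)^2 / (4 * s) := by
      have : (b i x * t)^2 = (|b i x| * t)^2 := by rw [mul_pow (b i x) t, mul_pow (|b i x|) t, sq_abs]
      rw [this]
      generalize |b i x| * t = y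
      generalize 2 * p + 5 * K * t = z
      have : s * y^2 + z^2/(4*s) - y * z = (2 * s * y - z)^2/(4*s) := by field_simp; ring
      have h : 0 ≤ (2 * s * y - z)^2/(4*s) := by positivity
      linarith
    have f6 : (2 * p + 5 * K * t)^2 ≤ (50 * K^2 + 8) * eD A U m u x := by
      have : (2 * p + 5 * K * t)^2 ≤ 8 * p^2 + 50 * K^2 * t^2 := by
        nlinarith [sq_nonneg (2 * p - 5 * K * t)]
      nlinarith [mul_le_mul_of_nonneg_left q3 (sq_nonneg K)]
    have f7 : (2 * p + 5 * K * t)^2 / (4 * s) ≤ (50 * K^2 + 8) / (4 * s) * eD A U m u x := by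
      rw [div_mul_eq_mul_div]; gcongr
    linarith
  rw [integral_add iφ (((ib i).const_mul _).fun_add (ie.const_mul _)), z, zero_add,
    integral_add ((ib i).const_mul _) (ie.const_mul _), integral_const_mul,
    integral_const_mul] at hle
  exact hle

end core

section core2
variable {d : ℕ}

inductive Reach {ι : Type} (chain : ι → ι → Fin d → Prop) (isB : ι → Fin d → Fin d → Prop)
    (isU : ι → Prop) : ι → Prop
  | baseB (i : ι) (j k : Fin d) : isB i j k → Reach chain isB isU i
  | baseU (i : ι) : isU i → Reach chain isB isU i
  | step (i i' : ι) (j : Fin d) : Reach chain isB isU i → chain i i' j → Reach chain isB isU i'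

variable {A : Fin d → Rd d → ℝ} {U : Rd d → ℝ}
variable {ι : Type} [Fintype ι] {chain : ι → ι → Fin d → Prop} {isB : ι → Fin d → Fin d → Prop}
  {isU : ι → Prop} {K : ℝ}

lemma eD_nonneg {m : Rd d → ℝ} {u : Rd d → ℂ} (hU0 : ∀ x, 0 ≤ U x) (x : Rd d) :
    0 ≤ eD A U m u x := (sq_nonneg _).trans (eD_u hU0 x)

lemma small_of_reach (hA : ∀ j, ContDiff ℝ 2 (A j)) (hU : Continuous U) (hU0 : ∀ x, 0 ≤ U x)
    (hK : 0 ≤ K) (i : ι) (hi : Reach chain isB isU i) :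
    ∀ ε > 0, ∃ μ0 : ℝ, ∀ μ ≥ μ0, 1 ≤ μ → ∀ m b, Pkg A U chain isB isU K μ m b →
      ∀ u : Rd d → ℂ, ContDiff ℝ (⊤ : ℕ∞) u → HasCompactSupport u →
      ∫ x, (b i x * (m x ^ 2 * ‖u x‖))^2 ≤ ε * ∫ x, eD A U m u x := by
  induction hi with
  | baseB i j k h =>
    intro ε hε
    refine ⟨(2 + 6 * K) / ε, fun μ hμ h1 m b P u hu hc => ?_⟩
    have h2 := step_B hA hU hU0 hu hc hK P i j k h
    have h3 : 0 ≤ ∫ x, eD A U m u x := integral_nonneg (fun x => eD_nonneg hU0 x)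
    have h4 : 2 + 6 * K ≤ μ * ε := (div_le_iff₀ hε).mp hμ
    have h5 := h2.trans (mul_le_mul_of_nonneg_right h4 h3)
    rw [mul_assoc] at h5
    exact le_of_mul_le_mul_left h5 (by linarith)
  | baseU i h =>
    intro ε hε
    refine ⟨1 / ε, fun μ hμ h1 m b P u hu hc => ?_⟩
    have h2 := step_U hA hU hU0 hu hc h1 P i h
    have h3 : 0 ≤ ∫ x, eD A U m u x := integral_nonneg (fun x => eD_nonneg hU0 x)
    have h4 : 1 ≤ μ * ε := (div_le_iff₀ hε).mp hμ
    have h5 := mul_le_mul_of_nonneg_right h4 h3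
    rw [one_mul, mul_assoc] at h5
    exact le_of_mul_le_mul_left (h2.trans h5) (by linarith)
  | step i i' j h hch ih =>
    intro ε hε
    set c : ℝ := 50 * K^2 + 8 with hc0
    have cpos : 0 < c := by positivity
    obtain ⟨μ0, h0⟩ := ih (ε^2 / c) (by positivity)
    refine ⟨μ0, fun μ hμ h1 m b P u hu hc => ?_⟩
    have h2 := h0 μ hμ h1 m b P u hu hc
    have h3 : 0 ≤ ∫ x, eD A U m u x := integral_nonneg (fun x => eD_nonneg hU0 x)
    have h4 := step_chain hA hU hU0 hu hc hK P i i' j hch (c / (2 * ε)) (by positivity)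
    refine h4.trans ?_
    have h5 := mul_le_mul_of_nonneg_left h2 (show 0 ≤ c / (2 * ε) by positivity)
    have e1 : c / (2 * ε) * (ε^2 / c * ∫ x, eD A U m u x) = ε / 2 * ∫ x, eD A U m u x := by
      field_simp
    have e2 : c / (4 * (c / (2 * ε))) = ε / 2 := by field_simp; ring
    rw [e1] at h5
    rw [← hc0, e2]
    linarith

lemma energy_le (hA : ∀ j, ContDiff ℝ 2 (A j)) (hU : Continuous U) (hU0 : ∀ x, 0 ≤ U x)
    (hK : 0 ≤ K) {μ : ℝ} {m : Rd d → ℝ} {b : ι → Rd d → ℝ} (P : Pkg A U chain isB isU K μ m b)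
    {u : Rd d → ℂ} (hu : ContDiff ℝ (⊤ : ℕ∞) u) (hc : HasCompactSupport u) :
    ∫ x, eD A U m u x ≤
      (∫ x, ‖(∑ j, Xop A j (Xop A j u) x) + (U x : ℂ) * u x‖^2) +
      (2 + 4 * d * K^2) * ∫ x, (m x ^ 2 * ‖u x‖)^2 := by
  have hu1 : ContDiff ℝ 1 u := contDiff_infty.mp hu 1
  have du : ∀ x, DifferentiableAt ℝ u x := hu1.differentiable (by norm_num)
  have dm : ∀ x, DifferentiableAt ℝ m x := P.mC.differentiable (by norm_num)
  have cm := P.mC.continuous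
  have cu := hu.continuous
  have hX1 := fun j => (X1 hA hu j)
  have hX2 := fun j k => (X2 hA hu j k)
  set f : Rd d → ℝ := fun x => m x ^ 2 with hf
  have cf : ContDiff ℝ 1 f := P.mC.pow 2
  have df : ∀ x, DifferentiableAt ℝ f x := cf.differentiable (by norm_num)
  set w : Rd d → ℂ := fun x => 1 * ((f x : ℂ) * u x) with hw
  have cw : ContDiff ℝ 1 w := contDiff_const.mul ((contDiff_ofReal' cf).mul hu1)
  have cX : ∀ j, Continuous (Xop A j w) := fun j => by
    have h1 : Continuous (pdC j w) := (pdC_contDiff (n := 0) j cw (by norm_num)).continuous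
    have := cw.continuous
    have := (hA j).continuous
    unfold Xop; fun_prop
  have s1 : ∀ j, ∫ x, rip (Xop A j (Xop A j u) x) (w x) = ∫ x, rip (Xop A j u x) (Xop A j w x) :=
    fun j => Xop_symm j (hA j).continuous ((hX1 j).of_le (by norm_num)) cw
      (Xop_hasCompactSupport hc)
  have i1 : ∀ j, Integrable (fun x => rip (Xop A j (Xop A j u) x) (w x)) := fun j =>
    integrable_of_vanish hc (rip_continuous (hX2 j j).continuous cw.continuous)
      (fun x hx => by simp [rip, XXop_zero hx])
  have i2 : ∀ j, Integrable (fun x => rip (Xop A j u x) (Xop A j w x)) := fun j =>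
    integrable_of_vanish hc (rip_continuous (hX1 j).continuous (cX j))
      (fun x hx => by simp [rip, Xop_zero hx])
  have i1s : Integrable (fun x => ∑ j, rip (Xop A j (Xop A j u) x) (w x)) :=
    integrable_finsetSum _ (fun j _ => i1 j)
  have i2s : Integrable (fun x => ∑ j, rip (Xop A j u x) (Xop A j w x)) :=
    integrable_finsetSum _ (fun j _ => i2 j)
  have hs : ∫ x, ∑ j, rip (Xop A j u x) (Xop A j w x) =
      ∫ x, ∑ j, rip (Xop A j (Xop A j u) x) (w x) := by
    rw [integral_finsetSum _ (fun j _ => i1 j), integral_finsetSum _ (fun j _ => i2 j)]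
    exact Finset.sum_congr rfl (fun j _ => (s1 j).symm)
  have iT : Integrable (fun x => (m x ^ 2 * ‖u x‖)^2) := by
    apply integrable_of_vanish hc (by fun_prop)
    intro x hx; simp [u_zero hx]
  have iQ : Integrable (fun x => ‖(∑ j, Xop A j (Xop A j u) x) + (U x : ℂ) * u x‖^2) := by
    apply integrable_of_vanish hc
    · have := fun j => (hX2 j j).continuous
      fun_prop
    · intro x hx; simp [u_zero hx, XXop_zero hx]
  have ie := eD_int hA hU cm hu hc
  have key : ∫ x, (eD A U m u x + 2 * ∑ j, rip (Xop A j (Xop A j u) x) (w x)) ≤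
      ∫ x, ((‖(∑ j, Xop A j (Xop A j u) x) + (U x : ℂ) * u x‖^2 +
      (2 + 4 * d * K^2) * (m x ^ 2 * ‖u x‖)^2) + 2 * ∑ j, rip (Xop A j u x) (Xop A j w x)) := by
    apply integral_mono (ie.fun_add (i1s.const_mul _))
      ((iQ.fun_add (iT.const_mul _)).fun_add (i2s.const_mul _))
    intro x
    simp only
    have m1 := P.m1 x
    have m0 : 0 < m x := by linarith
    have a1 : ∀ j, 1 / 2 * (m x * ‖Xop A j u x‖)^2 - 2 * K^2 * (m x ^ 2 * ‖u x‖)^2 ≤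
        rip (Xop A j u x) (Xop A j w x) := by
      intro j
      have e : rip (Xop A j u x) (Xop A j w x) = (m x * ‖Xop A j u x‖)^2 -
          pdR j f x * rip (Xop A j u x) (Complex.I * u x) := by
        rw [hw, Xop_mul j 1 (df x) (du x), mul_pow, ← rip_self]
        simp only [hf, rip, Complex.mul_re, Complex.mul_im, Complex.sub_re, Complex.sub_im,
          Complex.I_re, Complex.I_im, Complex.ofReal_re, Complex.ofReal_im, Complex.one_re,
          Complex.one_im]
        ring
      have e2 : pdR j f x = 2 * m x * pdR j m x := by
        rw [hf, pdR_pow j 2 (dm x)]; simp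
      have e3 : |pdR j f x| ≤ 2 * K * m x ^ 3 := by
        rw [e2, abs_mul, abs_mul, abs_two, abs_of_pos m0]
        calc _ ≤ 2 * m x * (K * m x ^ 2) := by gcongr; exact P.dm j x
          _ = _ := by ring
      have e4 : |rip (Xop A j u x) (Complex.I * u x)| ≤ ‖Xop A j u x‖ * ‖u x‖ := by
        simpa using abs_rip_le (Xop A j u x) (Complex.I * u x)
      have e5 : pdR j f x * rip (Xop A j u x) (Complex.I * u x) ≤
          2 * K * ((m x * ‖Xop A j u x‖) * (m x ^ 2 * ‖u x‖)) := by
        calc _ ≤ |pdR j f x * rip (Xop A j u x) (Complex.I * u x)| := le_abs_self _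
          _ = |pdR j f x| * |rip (Xop A j u x) (Complex.I * u x)| := abs_mul _ _
          _ ≤ (2 * K * m x ^ 3) * (‖Xop A j u x‖ * ‖u x‖) := by gcongr
          _ = _ := by ring
      rw [e]
      nlinarith [sq_nonneg (m x * ‖Xop A j u x‖ - 2 * K * (m x ^ 2 * ‖u x‖))]
    have a2 := Finset.sum_le_sum (s := Finset.univ) (fun j _ => a1 j)
    rw [Finset.sum_sub_distrib, ← Finset.mul_sum] at a2
    simp only [Finset.sum_const, Finset.card_univ, Fintype.card_fin, nsmul_eq_mul] at a2
    have a3 : ∑ j, rip (Xop A j (Xop A j u) x) (w x) + U x * (m x * ‖u x‖)^2 =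
        rip ((∑ j, Xop A j (Xop A j u) x) + (U x : ℂ) * u x) (w x) := by
      rw [rip_add_left, rip_sum_left, mul_pow, ← rip_self]
      congr 1
      simp only [hw, hf, rip, Complex.mul_re, Complex.mul_im, 
          Complex.ofReal_re, Complex.ofReal_im, Complex.one_re, Complex.one_im]
      ring
    have a4 := neg_le_of_abs_le (abs_rip_le ((∑ j, Xop A j (Xop A j u) x) + (U x : ℂ) * u x) (w x))
    have a4 := rip_le ((∑ j, Xop A j (Xop A j u) x) + (U x : ℂ) * u x) (w x)
    have a5 : ‖w x‖ = m x ^ 2 * ‖u x‖ := by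
      simp [hw, hf]
    rw [a5] at a4
    have hUn : 0 ≤ U x * (m x * ‖u x‖)^2 := mul_nonneg (hU0 x) (sq_nonneg _)
    unfold eD
    set N := ‖(∑ j, Xop A j (Xop A j u) x) + (U x : ℂ) * u x‖
    set t := m x ^ 2 * ‖u x‖
    nlinarith [sq_nonneg (N - t)]
  rw [integral_add ie (i1s.const_mul _), integral_add (iQ.fun_add (iT.const_mul _))
    (i2s.const_mul _), integral_add iQ (iT.const_mul _), integral_const_mul, integral_const_mul,
    integral_const_mul, hs] at key
  linarith
end core2

section core3
variable {d : ℕ}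
variable {A : Fin d → Rd d → ℝ} {U : Rd d → ℝ}
variable {ι : Type} [Fintype ι] {chain : ι → ι → Fin d → Prop} {isB : ι → Fin d → Fin d → Prop}
  {isU : ι → Prop} {K : ℝ}

lemma energy_bound (hA : ∀ j, ContDiff ℝ 2 (A j)) (hU : Continuous U) (hU0 : ∀ x, 0 ≤ U x)
    (hK : 0 ≤ K) {μ : ℝ} {m : Rd d → ℝ} {b : ι → Rd d → ℝ} (P : Pkg A U chain isB isU K μ m b)
    {ε : ℝ} (hε : Fintype.card ι * ε * (3 + 4 * d * K^2) ≤ 1 / 4) (hε0 : 0 ≤ ε)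
    {u : Rd d → ℂ} (hu : ContDiff ℝ (⊤ : ℕ∞) u) (hc : HasCompactSupport u)
    (hb : ∀ i, ∫ x, (b i x * (m x ^ 2 * ‖u x‖))^2 ≤ ε * ∫ x, eD A U m u x) :
    ∫ x, eD A U m u x ≤ (7 + 8 * d * K^2) *
      ((∫ x, ‖(∑ j, Xop A j (Xop A j u) x) + (U x : ℂ) * u x‖^2) + ∫ x, ‖u x‖^2) := by
  have h1 := energy_le hA hU hU0 hK P hu hc
  have cm := P.mC.continuous
  have cb := fun i => (P.bC i).continuous
  have cu := hu.continuous
  have iT : Integrable (fun x => (m x ^ 2 * ‖u x‖)^2) := by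
    apply integrable_of_vanish hc (by fun_prop)
    intro x hx; simp [u_zero hx]
  have iS : Integrable (fun x => ‖u x‖^2) := by
    apply integrable_of_vanish hc (by fun_prop)
    intro x hx; simp [u_zero hx]
  have ib : ∀ i, Integrable (fun x => (b i x * (m x ^ 2 * ‖u x‖))^2) := fun i => by
    apply integrable_of_vanish hc (by have := cb i; fun_prop)
    intro x hx; simp [u_zero hx]
  have ibs : Integrable (fun x => ∑ i, (b i x * (m x ^ 2 * ‖u x‖))^2) :=
    integrable_finsetSum _ (fun i _ => ib i)
  have h2 : ∫ x, (m x ^ 2 * ‖u x‖)^2 ≤ ∫ x, ((1 / 4 * (m x ^ 2 * ‖u x‖)^2 + ‖u x‖^2) +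
      ∑ i, (b i x * (m x ^ 2 * ‖u x‖))^2) := by
    apply integral_mono iT (((iT.const_mul _).fun_add iS).fun_add ibs)
    intro x
    simp only
    have hcov := mul_le_mul_of_nonneg_right (P.cover x) (sq_nonneg ‖u x‖)
    have e : ∑ i, (b i x * (m x ^ 2 * ‖u x‖))^2 = (∑ i, b i x ^ 2 * m x ^ 4) * ‖u x‖^2 := by
      rw [Finset.sum_mul]; exact Finset.sum_congr rfl (fun i _ => by ring)
    rw [e]
    have e2 : m x ^ 2 ≤ 1 / 4 * m x ^ 4 + 1 := by nlinarith [sq_nonneg (m x ^ 2 - 2)]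
    have e3 := mul_le_mul_of_nonneg_right e2 (sq_nonneg ‖u x‖)
    nlinarith
  rw [integral_add ((iT.const_mul _).fun_add iS) ibs, integral_add (iT.const_mul _) iS,
    integral_const_mul, integral_finsetSum _ (fun i _ => ib i)] at h2
  have h3 := Finset.sum_le_sum (s := Finset.univ) (fun i _ => hb i)
  simp only [Finset.sum_const, Finset.card_univ, nsmul_eq_mul] at h3
  have hT : 0 ≤ ∫ x, (m x ^ 2 * ‖u x‖)^2 := integral_nonneg (fun x => by positivity)
  have hS : 0 ≤ ∫ x, ‖u x‖^2 := integral_nonneg (fun x => by positivity)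
  have hQ : 0 ≤ ∫ x, ‖(∑ j, Xop A j (Xop A j u) x) + (U x : ℂ) * u x‖^2 :=
    integral_nonneg (fun x => by positivity)
  set T := ∫ x, (m x ^ 2 * ‖u x‖)^2
  set S := ∫ x, ‖u x‖^2
  set Q := ∫ x, ‖(∑ j, Xop A j (Xop A j u) x) + (U x : ℂ) * u x‖^2
  set E := ∫ x, eD A U m u x
  set c : ℝ := 2 + 4 * d * K^2 with hcdef
  have c2 : 2 ≤ c := by
    have : (0:ℝ) ≤ 4 * d * K^2 := by positivity
    linarith
  have hδ : 0 ≤ Fintype.card ι * ε := by positivity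
  have hh : Fintype.card ι * ε * (1 + c) ≤ 1 / 4 := by rw [hcdef]; linarith
  have h4 : (Fintype.card ι : ℝ) * (ε * E) ≤ 1 / 4 * (Q + T) := by
    have a : E ≤ (1 + c) * (Q + T) := by nlinarith
    calc (Fintype.card ι : ℝ) * (ε * E) = Fintype.card ι * ε * E := by ring
      _ ≤ Fintype.card ι * ε * ((1 + c) * (Q + T)) := by gcongr
      _ = (Fintype.card ι * ε * (1 + c)) * (Q + T) := by ring
      _ ≤ _ := by gcongr
  have h5 : T ≤ 2 * S + Q := by linarith
  have e7 : 7 + 8 * (d:ℝ) * K^2 = 3 + 2 * c := by rw [hcdef]; ring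
  rw [e7]
  nlinarith

lemma second_order (hA : ∀ j, ContDiff ℝ 2 (A j)) (hU : Continuous U) (hU0 : ∀ x, 0 ≤ U x)
    {μ : ℝ} (hμ : 1 ≤ μ) {m : Rd d → ℝ} {b : ι → Rd d → ℝ} (P : Pkg A U chain isB isU K μ m b)
    {u : Rd d → ℂ} (hu : ContDiff ℝ (⊤ : ℕ∞) u) (hc : HasCompactSupport u) :
    ∑ j, ∑ l, ∫ x, ‖Xop A j (Xop A l u) x‖^2 ≤
      4 * (∫ x, ‖(∑ j, Xop A j (Xop A j u) x) + (U x : ℂ) * u x‖^2) +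
      (4 * μ^2 + d * d * (2 * μ + μ^2)) * ∫ x, eD A U m u x := by
  have hA1 : ∀ j, ContDiff ℝ 1 (A j) := fun j => (hA j).of_le (by norm_num)
  have hu2 : ContDiff ℝ 2 u := contDiff_infty.mp hu 2
  have cm := P.mC.continuous
  have cu := hu.continuous
  have hX1 := fun j => (X1 hA hu j)
  have hX2 := fun j k => (X2 hA hu j k)
  have hX3 : ∀ i j k, Continuous (Xop A i (Xop A j (Xop A k u))) := fun i j k =>
    (Xop_contDiff (n := 0) ((hA i).of_le (by norm_num)) ((hX2 j k).of_le (by norm_num))).continuous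
  have iQ : Integrable (fun x => ‖(∑ j, Xop A j (Xop A j u) x) + (U x : ℂ) * u x‖^2) := by
    apply integrable_of_vanish hc
    · have := fun j => (hX2 j j).continuous
      fun_prop
    · intro x hx; simp [u_zero hx, XXop_zero hx]
  have ie := eD_int hA hU cm hu hc
  have iXX : ∀ j l, Integrable (fun x => ‖Xop A j (Xop A l u) x‖^2) := fun j l => by
    apply integrable_of_vanish hc
    · have := (hX2 j l).continuous
      fun_prop
    · intro x hx; simp [XXop_zero hx]
  have ir : ∀ j l j' l', Integrable (fun x => rip (Xop A j (Xop A l u) x)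
      (Xop A j' (Xop A l' u) x)) := fun j l j' l' => by
    apply integrable_of_vanish hc
    · exact rip_continuous (hX2 j l).continuous (hX2 j' l').continuous
    · intro x hx; simp [rip, XXop_zero hx]
  have i3 : ∀ i j l k, Integrable (fun x => rip (Xop A i (Xop A j (Xop A l u)) x)
      (Xop A k u x)) := fun i j l k => by
    apply integrable_of_vanish hc
    · exact rip_continuous (hX3 i j l) (hX1 k).continuous
    · intro x hx; simp [rip, Xop_zero hx]
  have one : ∀ j l, ∫ x, ‖Xop A j (Xop A l u) x‖^2 ≤
      2 * (∫ x, rip (Xop A l (Xop A l u) x) (Xop A j (Xop A j u) x)) +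
      (2 * μ + μ^2) * ∫ x, eD A U m u x := by
    intro j l
    have s1 : ∫ x, rip (Xop A l (Xop A j (Xop A l u)) x) (Xop A j u x) =
        ∫ x, rip (Xop A j (Xop A l u) x) (Xop A l (Xop A j u) x) :=
      Xop_symm l (hA l).continuous (hX2 j l) ((hX1 j).of_le (by norm_num))
        (Xop_hasCompactSupport (Xop_hasCompactSupport hc))
    have s2 : ∫ x, rip (Xop A j (Xop A l (Xop A l u)) x) (Xop A j u x) =
        ∫ x, rip (Xop A l (Xop A l u) x) (Xop A j (Xop A j u) x) :=
      Xop_symm j (hA j).continuous (hX2 l l) ((hX1 j).of_le (by norm_num))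
        (Xop_hasCompactSupport (Xop_hasCompactSupport hc))
    have le1 : ∫ x, rip (Xop A l (Xop A j (Xop A l u)) x) (Xop A j u x) ≤
        ∫ x, (rip (Xop A j (Xop A l (Xop A l u)) x) (Xop A j u x) + μ * eD A U m u x) := by
      apply integral_mono (i3 l j l j) ((i3 j l l j).fun_add (ie.const_mul _))
      intro x
      simp only
      rw [Xop_commutator hA1 (hX1 l) l j x, rip_add_left]
      gcongr
      have a1 := rip_le (Complex.I * (magB A l j x : ℂ) * Xop A l u x) (Xop A j u x)
      rw [norm_mul, norm_mul, Complex.norm_I, one_mul, Complex.norm_real, Real.norm_eq_abs] at a1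
      have b1 := eD_X (A := A) (m := m) (u := u) hU0 j x
      have b2 := eD_X (A := A) (m := m) (u := u) hU0 l x
      calc _ ≤ |magB A l j x| * ‖Xop A l u x‖ * ‖Xop A j u x‖ := a1
        _ ≤ (μ * m x ^ 2) * ‖Xop A l u x‖ * ‖Xop A j u x‖ := by gcongr; exact P.Ble l j x
        _ = μ * ((m x * ‖Xop A l u x‖) * (m x * ‖Xop A j u x‖)) := by ring
        _ ≤ μ * eD A U m u x := by
          gcongr
          nlinarith [sq_nonneg ((m x * ‖Xop A l u x‖) - (m x * ‖Xop A j u x‖))]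
    rw [integral_add (i3 j l l j) (ie.const_mul _), integral_const_mul, s1, s2] at le1
    have le2 : ∫ x, ‖Xop A j (Xop A l u) x‖^2 ≤
        ∫ x, (2 * rip (Xop A j (Xop A l u) x) (Xop A l (Xop A j u) x) + μ^2 * eD A U m u x) := by
      apply integral_mono (iXX j l) (((ir j l l j).const_mul _).fun_add (ie.const_mul _))
      intro x
      simp only
      have e : ‖Xop A j (Xop A l u) x‖^2 = rip (Xop A j (Xop A l u) x) (Xop A l (Xop A j u) x) +
          rip (Xop A j (Xop A l u) x) (Complex.I * (magB A j l x : ℂ) * u x) := by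
        rw [← rip_add_right, ← Xop_commutator hA1 hu2 j l x, rip_self]
      have a1 := rip_le (Xop A j (Xop A l u) x) (Complex.I * (magB A j l x : ℂ) * u x)
      rw [norm_mul, norm_mul, Complex.norm_I, one_mul, Complex.norm_real, Real.norm_eq_abs] at a1
      have b3 := eD_u (A := A) (m := m) (u := u) hU0 x
      have a2 : |magB A j l x| * ‖u x‖ ≤ μ * (m x ^ 2 * ‖u x‖) := by
        rw [← mul_assoc]; gcongr; exact P.Ble j l x
      have a3 : (|magB A j l x| * ‖u x‖)^2 ≤ μ^2 * eD A U m u x := by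
        calc _ ≤ (μ * (m x ^ 2 * ‖u x‖))^2 := by gcongr
          _ = μ^2 * (m x ^ 2 * ‖u x‖)^2 := by ring
          _ ≤ _ := by gcongr
      nlinarith [sq_nonneg (‖Xop A j (Xop A l u) x‖ - |magB A j l x| * ‖u x‖)]
    rw [integral_add ((ir j l l j).const_mul _) (ie.const_mul _), integral_const_mul,
      integral_const_mul] at le2
    linarith
  have sum := Finset.sum_le_sum (s := Finset.univ) (fun j _ =>
    Finset.sum_le_sum (s := Finset.univ) (fun l _ => one j l))
  refine sum.trans ?_
  have e1 : ∑ j, ∑ l, (∫ x, rip (Xop A l (Xop A l u) x) (Xop A j (Xop A j u) x)) =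
      ∫ x, ‖∑ j, Xop A j (Xop A j u) x‖^2 := by
    have : ∀ j, ∑ l, (∫ x, rip (Xop A l (Xop A l u) x) (Xop A j (Xop A j u) x)) =
        ∫ x, ∑ l, rip (Xop A l (Xop A l u) x) (Xop A j (Xop A j u) x) := fun j =>
      (integral_finsetSum _ (fun l _ => ir l l j j)).symm
    simp_rw [this]
    rw [← integral_finsetSum _ (fun j _ => integrable_finsetSum _ (fun l _ => ir l l j j))]
    congr 1; ext x
    rw [← rip_self, rip_sum_right]
    exact Finset.sum_congr rfl (fun j _ => (rip_sum_left _ _ _).symm)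
  have iL : Integrable (fun x => ‖∑ j, Xop A j (Xop A j u) x‖^2) := by
    apply integrable_of_vanish hc
    · have := fun j => (hX2 j j).continuous
      fun_prop
    · intro x hx; simp [XXop_zero hx]
  have e2 : ∫ x, ‖∑ j, Xop A j (Xop A j u) x‖^2 ≤
      ∫ x, (2 * ‖(∑ j, Xop A j (Xop A j u) x) + (U x : ℂ) * u x‖^2 + 2 * μ^2 * eD A U m u x) := by
    apply integral_mono iL ((iQ.const_mul _).fun_add (ie.const_mul _))
    intro x
    simp only
    have a1 : ‖∑ j, Xop A j (Xop A j u) x‖ ≤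
        ‖(∑ j, Xop A j (Xop A j u) x) + (U x : ℂ) * u x‖ + U x * ‖u x‖ := by
      have := norm_sub_le ((∑ j, Xop A j (Xop A j u) x) + (U x : ℂ) * u x) ((U x : ℂ) * u x)
      rwa [add_sub_cancel_right, norm_mul, Complex.norm_real, Real.norm_eq_abs,
        abs_of_nonneg (hU0 x)] at this
    have b3 := eD_u (A := A) (m := m) (u := u) hU0 x
    have a2 : U x * ‖u x‖ ≤ μ * (m x ^ 2 * ‖u x‖) := by
      rw [← mul_assoc]; gcongr; exact P.Ule x
    have a0 : 0 ≤ U x * ‖u x‖ := mul_nonneg (hU0 x) (norm_nonneg _)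
    have a3 : (U x * ‖u x‖)^2 ≤ μ^2 * eD A U m u x := by
      calc _ ≤ (μ * (m x ^ 2 * ‖u x‖))^2 := by gcongr
        _ = μ^2 * (m x ^ 2 * ‖u x‖)^2 := by ring
        _ ≤ _ := by gcongr
    have a4 : ‖∑ j, Xop A j (Xop A j u) x‖^2 ≤
        (‖(∑ j, Xop A j (Xop A j u) x) + (U x : ℂ) * u x‖ + U x * ‖u x‖)^2 := by gcongr
    nlinarith [sq_nonneg (‖(∑ j, Xop A j (Xop A j u) x) + (U x : ℂ) * u x‖ - U x * ‖u x‖)]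
  rw [integral_add (iQ.const_mul _) (ie.const_mul _), integral_const_mul,
    integral_const_mul] at e2
  simp only [Finset.sum_add_distrib, ← Finset.mul_sum, e1]
  simp only [Finset.sum_const, Finset.card_univ, Fintype.card_fin, nsmul_eq_mul]
  nlinarith

theorem core_main (hA : ∀ j, ContDiff ℝ 2 (A j)) (hU : Continuous U) (hU0 : ∀ x, 0 ≤ U x)
    (hK : 0 ≤ K) (hreach : ∀ i, Reach chain isB isU i)
    (hP : ∀ μ : ℝ, 1 ≤ μ → ∃ (m : Rd d → ℝ) (b : ι → Rd d → ℝ), Pkg A U chain isB isU K μ m b) :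
    ∃ C' > 0, ∀ u : Rd d → ℂ, ContDiff ℝ (⊤ : ℕ∞) u → HasCompactSupport u →
      (∑ j, ∑ ℓ, Real.sqrt (∫ x : Rd d, ‖Xop A j (Xop A ℓ u) x‖^2))
        ≤ C' * (Real.sqrt (∫ x : Rd d,
              ‖(∑ j, Xop A j (Xop A j u) x) + (U x : ℂ) * u x‖^2)
            + Real.sqrt (∫ x : Rd d, ‖u x‖^2)) := by
  set n : ℝ := ((Fintype.card ι : ℕ) : ℝ) with hn
  have n0 : 0 ≤ n := by positivity
  set k : ℝ := 3 + 4 * d * K^2 with hk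
  have k0 : 0 < k := by positivity
  set ε : ℝ := 1 / (4 * (n + 1) * k) with hε
  have ε0 : 0 < ε := by positivity
  have hεle : n * ε * k ≤ 1 / 4 := by
    rw [hε]
    have : n * (1 / (4 * (n + 1) * k)) * k = n / (n + 1) / 4 := by field_simp
    rw [this]
    have : n / (n + 1) ≤ 1 := by rw [div_le_one (by positivity)]; linarith
    linarith
  have hsm := fun i => small_of_reach (A := A) (U := U) hA hU hU0 hK i (hreach i) ε ε0
  choose μi hμi using hsm
  set μ : ℝ := 1 + ∑ i, |μi i| with hμ
  have hs0 : 0 ≤ ∑ i, |μi i| := Finset.sum_nonneg (fun i _ => abs_nonneg _)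
  have μ1 : 1 ≤ μ := by linarith
  have μge : ∀ i, μi i ≤ μ := fun i => by
    have h1 : |μi i| ≤ ∑ i, |μi i| :=
      Finset.single_le_sum (f := fun i => |μi i|) (fun i _ => abs_nonneg _) (Finset.mem_univ i)
    have h2 := le_abs_self (μi i)
    linarith
  obtain ⟨m, b, P⟩ := hP μ μ1
  set c1 : ℝ := 7 + 8 * d * K^2 with hc1
  have c10 : 0 < c1 := by positivity
  set c2 : ℝ := 4 * μ^2 + d * d * (2 * μ + μ^2) with hc2
  have c20 : 0 < c2 := by positivity
  set M : ℝ := 4 + c2 * c1 with hM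
  have M0 : 0 < M := by positivity
  refine ⟨(d * d) * Real.sqrt M + 1, by positivity, fun u hu hc => ?_⟩
  have h1 := energy_bound hA hU hU0 hK P hεle ε0.le hu hc
    (fun i => hμi i μ (μge i) μ1 m b P u hu hc)
  have h2 := second_order hA hU hU0 μ1 P hu hc
  have hS : 0 ≤ ∫ x, ‖u x‖^2 := integral_nonneg (fun x => by positivity)
  have hQ : 0 ≤ ∫ x, ‖(∑ j, Xop A j (Xop A j u) x) + (U x : ℂ) * u x‖^2 :=
    integral_nonneg (fun x => by positivity)
  set S := ∫ x, ‖u x‖^2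
  set Q := ∫ x, ‖(∑ j, Xop A j (Xop A j u) x) + (U x : ℂ) * u x‖^2
  set E := ∫ x, eD A U m u x
  have h3 : ∑ j, ∑ l, ∫ x, ‖Xop A j (Xop A l u) x‖^2 ≤ M * (Q + S) := by
    have : c2 * E ≤ c2 * (c1 * (Q + S)) := by gcongr
    rw [hM]; nlinarith
  have h4 : ∀ j l, Real.sqrt (∫ x, ‖Xop A j (Xop A l u) x‖^2) ≤
      Real.sqrt M * (Real.sqrt Q + Real.sqrt S) := by
    intro j l
    have hnn : ∀ j l, 0 ≤ ∫ x, ‖Xop A j (Xop A l u) x‖^2 :=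
      fun j l => integral_nonneg (fun x => by positivity)
    have a1 : ∫ x, ‖Xop A j (Xop A l u) x‖^2 ≤ ∑ j, ∑ l, ∫ x, ‖Xop A j (Xop A l u) x‖^2 := by
      refine le_trans ?_ (Finset.single_le_sum
        (f := fun j => ∑ l, ∫ x, ‖Xop A j (Xop A l u) x‖^2)
        (fun i _ => Finset.sum_nonneg (fun l _ => hnn i l)) (Finset.mem_univ j))
      exact Finset.single_le_sum (f := fun l => ∫ x, ‖Xop A j (Xop A l u) x‖^2)
        (fun i _ => hnn j i) (Finset.mem_univ l)
    calc _ ≤ Real.sqrt (M * (Q + S)) := Real.sqrt_le_sqrt (a1.trans h3)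
      _ = Real.sqrt M * Real.sqrt (Q + S) := Real.sqrt_mul M0.le _
      _ ≤ _ := by
        gcongr
        rw [Real.sqrt_le_left (by positivity)]
        nlinarith [Real.sq_sqrt hQ, Real.sq_sqrt hS, Real.sqrt_nonneg Q, Real.sqrt_nonneg S,
          mul_nonneg (Real.sqrt_nonneg Q) (Real.sqrt_nonneg S)]
  have h5 := Finset.sum_le_sum (s := Finset.univ) (fun j _ =>
    Finset.sum_le_sum (s := Finset.univ) (fun l _ => h4 j l))
  simp only [Finset.sum_const, Finset.card_univ, Fintype.card_fin, nsmul_eq_mul] at h5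
  refine h5.trans ?_
  nlinarith [Real.sqrt_nonneg Q, Real.sqrt_nonneg S]

end core3

section construct
variable {d : ℕ}

lemma weight_exists {ι : Type} [Fintype ι] (w : ι → ℕ) (hw : ∀ i, 1 ≤ w i) :
    ∃ (N : ℕ) (p : ι → ℕ), 1 ≤ N ∧ ∀ i, 1 ≤ p i ∧ p i * w i = N := by
  have hN : 0 < ∏ i, w i := Finset.prod_pos (fun i _ => hw i)
  refine ⟨∏ i, w i, fun i => (∏ i, w i) / w i, hN, fun i => ?_⟩
  have hd : w i ∣ ∏ i, w i := Finset.dvd_prod_of_mem w (Finset.mem_univ i)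
  exact ⟨Nat.div_pos (Nat.le_of_dvd hN hd) (hw i), Nat.div_mul_cancel hd⟩

/-- The abstract construction of the weight function. -/
lemma weight_construct {ι : Type} [Fintype ι] (w : ι → ℕ) (N : ℕ) (p : ι → ℕ) (hN : 1 ≤ N)
    (hp : ∀ i, 1 ≤ p i ∧ p i * w i = N) (f : ι → Rd d → ℝ) (hf : ∀ i, ContDiff ℝ 1 (f i))
    {K0 : ℝ} (hK0 : 0 ≤ K0)
    (H : ∀ i k x (M : ℝ), 1 ≤ M → (∀ i', |f i' x| ≤ M^(w i')) →
      |pdR k (f i) x| ≤ K0 * M^(w i + 1)) :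
    ∃ m : Rd d → ℝ, (∀ x, 1 ≤ m x) ∧ ContDiff ℝ 1 m ∧
      (∀ x, m x ^ (2*N) = 1 + ∑ i, f i x ^ (2 * p i)) ∧
      (∀ i x, |f i x| ≤ m x ^ (w i)) ∧
      (∀ i k x, |pdR k (f i) x| ≤ K0 * m x^(w i + 1)) ∧
      (∀ k x, |pdR k m x| ≤ (∑ i, 2 * p i * K0) * m x ^ 2) := by
  set G : Rd d → ℝ := fun x => 1 + ∑ i, f i x ^ (2 * p i) with hG
  have G1 : ∀ x, 1 ≤ G x := fun x => by
    have : 0 ≤ ∑ i, f i x ^ (2 * p i) :=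
      Finset.sum_nonneg (fun i _ => by rw [pow_mul]; positivity)
    simp only [hG]; linarith
  have GC : ContDiff ℝ 1 G := by
    apply contDiff_const.add
    apply ContDiff.sum
    intro i _
    exact (hf i).pow _
  set m : Rd d → ℝ := fun x => (G x) ^ (((2*N : ℕ) : ℝ)⁻¹) with hm
  have m1 : ∀ x, 1 ≤ m x := fun x => Real.one_le_rpow (G1 x) (by positivity)
  have mC : ContDiff ℝ 1 m :=
    GC.rpow_const_of_ne (fun x => by have := G1 x; positivity)
  have mG : ∀ x, m x ^ (2*N) = G x := fun x =>
    Real.rpow_inv_natCast_pow (by linarith [G1 x]) (by omega)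
  have fm : ∀ i x, |f i x| ≤ m x ^ (w i) := by
    intro i x
    have h1 : |f i x| ^ (2 * p i) ≤ (m x ^ (w i)) ^ (2 * p i) := by
      rw [← pow_mul, show w i * (2 * p i) = 2 * N by rw [← (hp i).2]; ring, mG, pow_mul, sq_abs,
        ← pow_mul]
      have := Finset.single_le_sum (f := fun i => f i x ^ (2 * p i))
        (fun i _ => by rw [pow_mul]; positivity) (Finset.mem_univ i)
      simp only [hG]
      linarith
    exact le_of_pow_le_pow_left₀ (by have := (hp i).1; omega) (by have := m1 x; positivity) h1
  have dfm : ∀ i k x, |pdR k (f i) x| ≤ K0 * m x^(w i + 1) :=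
    fun i k x => H i k x (m x) (m1 x) (fun i' => fm i' x)
  refine ⟨m, m1, mC, mG, fm, dfm, fun k x => ?_⟩
  have df : ∀ i, DifferentiableAt ℝ (f i) x := fun i => (hf i).differentiable one_ne_zero x
  have dmm : DifferentiableAt ℝ m x := mC.differentiable one_ne_zero x
  have mpos : 0 < m x := by linarith [m1 x]
  have e1 : pdR k (fun y => m y ^ (2*N)) x = pdR k G x := by
    congr 1; funext y; exact mG y
  have e2 : pdR k G x = ∑ i, ((2 * p i : ℕ) : ℝ) * f i x ^ (2 * p i - 1) * pdR k (f i) x := by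
    have : pdR k G x = pdR k (fun _ => (1:ℝ)) x + pdR k (fun y => ∑ i, f i y ^ (2 * p i)) x := by
      rw [← pdR_add k (by fun_prop) (DifferentiableAt.fun_sum (fun i _ => (df i).fun_pow _))]
    rw [this, pdR_const, zero_add, pdR_sum _ _ (fun i _ => (df i).fun_pow _)]
    refine Finset.sum_congr rfl (fun i _ => ?_)
    rw [pdR_pow k _ (df i)]
  rw [pdR_pow k _ dmm, e2] at e1
  have h2 : |((2 * N : ℕ) : ℝ) * m x ^ (2 * N - 1) * pdR k m x| ≤
      (∑ i, 2 * p i * K0) * m x ^ (2 * N + 1) := by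
    rw [e1, Finset.sum_mul]
    refine (Finset.abs_sum_le_sum_abs _ _).trans (Finset.sum_le_sum (fun i _ => ?_))
    rw [abs_mul, abs_mul, abs_pow]
    obtain ⟨q, hq⟩ : ∃ q, p i = q + 1 := ⟨p i - 1, by have := (hp i).1; omega⟩
    have hNq := (hp i).2
    have e3 : (m x ^ w i) ^ (2 * p i - 1) * m x ^ (w i + 1) = m x ^ (2 * N + 1) := by
      rw [← pow_mul, ← pow_add]
      congr 1
      rw [← hNq, hq, show 2 * (q+1) - 1 = 2 * q + 1 by omega]
      ring
    calc |((2 * p i : ℕ) : ℝ)| * |f i x| ^ (2 * p i - 1) * |pdR k (f i) x|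
        ≤ |((2 * p i : ℕ) : ℝ)| * (m x ^ w i) ^ (2 * p i - 1) * (K0 * m x^(w i + 1)) := by
          gcongr
          · exact fm i x
          · exact dfm i k x
      _ = 2 * p i * K0 * ((m x ^ w i) ^ (2 * p i - 1) * m x ^ (w i + 1)) := by
          rw [abs_of_nonneg (by positivity)]; push_cast; ring
      _ = _ := by rw [e3]
  rw [abs_mul, abs_of_nonneg (by positivity),
    show 2 * N + 1 = (2 * N - 1) + 2 by omega, pow_add] at h2
  have h3 : m x ^ (2*N-1) * |pdR k m x| ≤ ((2 * N : ℕ) : ℝ) * m x ^ (2 * N - 1) * |pdR k m x| := by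
    have : (1:ℝ) ≤ ((2 * N : ℕ) : ℝ) := by exact_mod_cast (by omega)
    rw [mul_assoc]
    exact le_mul_of_one_le_left (by positivity) this
  have h4 : m x ^ (2*N-1) * |pdR k m x| ≤ m x ^ (2*N-1) * ((∑ i, 2 * p i * K0) * m x ^ 2) := by
    linarith
  exact le_of_mul_le_mul_left h4 (by positivity)

lemma pkg_exists {A : Fin d → Rd d → ℝ} {U : Rd d → ℝ} {ι : Type} [Fintype ι]
    (chain : ι → ι → Fin d → Prop) (isB : ι → Fin d → Fin d → Prop) (isU : ι → Prop)
    (g : ι → Rd d → ℝ) (hg : ∀ i, ContDiff ℝ 1 (g i)) (w : ι → ℕ) (hw : ∀ i, 1 ≤ w i)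
    {K0 : ℝ} (hK0 : 0 ≤ K0)
    (H2 : ∀ i k x (μ M : ℝ), 1 ≤ μ → 1 ≤ M → (∀ i', |g i' x| ≤ μ * M^(w i')) →
      |pdR k (g i) x| ≤ K0 * (μ * M^(w i + 1)))
    (hchain : ∀ i i' j, chain i i' j → g i' = pdR j (g i) ∧ w i' = w i + 1)
    (hB : ∀ i j k, isB i j k → g i = magB A j k ∧ w i = 2)
    (hU : ∀ i, isU i → g i = U ∧ w i = 2)
    (hBle : ∀ j k x (M : ℝ), 0 ≤ M → (∀ i, w i = 2 → |g i x| ≤ M) → |magB A j k x| ≤ M)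
    (hexU : ∃ i, isU i) :
    ∃ K : ℝ, 0 ≤ K ∧ ∀ μ : ℝ, 1 ≤ μ →
      ∃ (m : Rd d → ℝ) (b : ι → Rd d → ℝ), Pkg A U chain isB isU K μ m b := by
  obtain ⟨N, p, hN, hp⟩ := weight_exists w hw
  set S : ℝ := ∑ i, 2 * p i * K0 with hS
  have S0 : 0 ≤ S := Finset.sum_nonneg (fun i _ => by positivity)
  set W : ℝ := ∑ i, (w i : ℝ) with hW
  have W0 : 0 ≤ W := Finset.sum_nonneg (fun i _ => by positivity)
  have hwW : ∀ i, (w i : ℝ) ≤ W := fun i =>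
    Finset.single_le_sum (f := fun i => (w i : ℝ)) (fun i _ => by positivity) (Finset.mem_univ i)
  have hwS : ∀ i, (w i : ℝ) * S ≤ W * S := fun i => by gcongr; exact hwW i
  have WS0 : 0 ≤ W * S := by positivity
  refine ⟨K0 + W * S + S, by positivity, fun μ hμ => ?_⟩
  have μ0 : 0 < μ := by linarith
  set f : ι → Rd d → ℝ := fun i x => g i x / μ with hf
  have gf : ∀ i x, g i x = μ * f i x := fun i x => by simp only [hf]; field_simp
  have fC : ∀ i, ContDiff ℝ 1 (f i) := fun i => (hg i).div_const μ
  have df : ∀ i x, DifferentiableAt ℝ (f i) x := fun i x => (fC i).differentiable one_ne_zero x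
  have pg : ∀ i k x, pdR k (g i) x = μ * pdR k (f i) x := fun i k x => by
    have : g i = fun x => μ * f i x := funext (gf i)
    rw [this, pdR_mul k (by fun_prop) (df i x), pdR_const]
    ring
  obtain ⟨m, m1, mC, mG, fm, dfm, dm⟩ := weight_construct w N p hN hp f fC hK0 (by
    intro i k x M hM h
    have := H2 i k x μ M hμ hM (fun i' => by
      rw [gf, abs_mul, abs_of_pos μ0]; gcongr; exact h i')
    rw [pg, abs_mul, abs_of_pos μ0] at this
    have h2 : μ * |pdR k (f i) x| ≤ μ * (K0 * M^(w i + 1)) := by linarith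
    exact le_of_mul_le_mul_left h2 μ0)
  have mp : ∀ x, 0 < m x := fun x => by linarith [m1 x]
  have dmm : ∀ x, DifferentiableAt ℝ m x := fun x => mC.differentiable one_ne_zero x
  set b : ι → Rd d → ℝ := fun i x => f i x / m x ^ (w i) with hb
  have bC : ∀ i, ContDiff ℝ 1 (b i) := fun i =>
    (fC i).div (mC.pow _) (fun x => (pow_pos (mp x) _).ne')
  have fb : ∀ i x, f i x = b i x * m x ^ (w i) := fun i x => by
    have := (pow_pos (mp x) (w i)).ne'
    simp only [hb]; field_simp
  have b1 : ∀ i x, |b i x| ≤ 1 := fun i x => by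
    simp only [hb]
    rw [abs_div, abs_of_pos (pow_pos (mp x) _), div_le_one (pow_pos (mp x) _)]
    exact fm i x
  have dfb : ∀ i k x, pdR k (f i) x =
      b i x * (w i * m x ^ (w i - 1) * pdR k m x) + m x ^ (w i) * pdR k (b i) x := by
    intro i k x
    have : f i = fun x => b i x * m x ^ (w i) := funext (fb i)
    rw [this, pdR_mul k ((bC i).differentiable one_ne_zero x) ((dmm x).fun_pow _), pdR_pow k _ (dmm x)]
  have key : ∀ i k x, |b i x * (w i * m x ^ (w i - 1) * pdR k m x)| ≤
      m x ^ (w i) * (w i * S * |b i x| * m x) := by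
    intro i k x
    have mpx := mp x
    obtain ⟨v, hv⟩ : ∃ v, w i = v + 1 := ⟨w i - 1, by have := hw i; omega⟩
    rw [abs_mul, abs_mul, abs_mul, abs_of_nonneg (Nat.cast_nonneg (α := ℝ) (w i)),
      abs_of_pos (pow_pos mpx (w i - 1))]
    calc |b i x| * (w i * m x ^ (w i - 1) * |pdR k m x|)
        ≤ |b i x| * (w i * m x ^ (w i - 1) * (S * m x ^ 2)) := by gcongr; exact dm k x
      _ = _ := by rw [hv, Nat.add_sub_cancel]; ring
  have hBB : ∀ i, w i = 2 → ∀ x, |g i x| ≤ μ * m x ^ 2 := fun i hi x => by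
    rw [gf, abs_mul, abs_of_pos μ0]; gcongr; rw [← hi]; exact fm i x
  refine ⟨m, b, ?_⟩
  constructor
  · exact m1
  · exact mC
  · exact bC
  · exact b1
  · intro k x
    refine (dm k x).trans ?_
    have := sq_nonneg (m x)
    gcongr
    linarith
  · intro i k x
    have mpx := mp x
    have h1 := dfb i k x
    have h2 := dfm i k x
    have h3 := key i k x
    have hp0 := pow_pos mpx (w i)
    have h4 : m x ^ (w i) * |pdR k (b i) x| ≤ m x ^ (w i) * ((K0 + w i * S) * m x) := by
      rw [← abs_of_pos hp0, ← abs_mul, abs_of_pos hp0,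
        show m x ^ (w i) * pdR k (b i) x =
          pdR k (f i) x - b i x * (w i * m x ^ (w i - 1) * pdR k m x) by rw [h1]; ring]
      refine (abs_sub _ _).trans ?_
      have h5 : m x ^ (w i) * (w i * S * |b i x| * m x) ≤ m x ^ (w i) * (w i * S * 1 * m x) := by
        gcongr; exact b1 i x
      rw [pow_succ] at h2
      nlinarith
    refine (le_of_mul_le_mul_left h4 hp0).trans (mul_le_mul_of_nonneg_right ?_ mpx.le)
    linarith [hwS i]
  · intro i j k h x
    obtain ⟨h1, h2⟩ := hB i j k h
    rw [← h1, gf, fb, h2]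
  · intro i h x
    obtain ⟨h1, h2⟩ := hU i h
    rw [← h1, gf, fb, h2]
  · intro i i' j h x
    obtain ⟨h1, h2⟩ := hchain i i' j h
    have mpx := mp x
    have hp0 := pow_pos mpx (w i)
    have e1 : f i' x = pdR j (f i) x := by
      have := gf i' x
      rw [h1, pg] at this
      exact (mul_left_cancel₀ μ0.ne' this).symm
    rw [fb i', h2, dfb i] at e1
    have h4 : m x ^ (w i) * |b i' x * m x - pdR j (b i) x| ≤
        m x ^ (w i) * (w i * S * |b i x| * m x) := by
      rw [← abs_of_pos hp0, ← abs_mul, abs_of_pos hp0,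
        show m x ^ (w i) * (b i' x * m x - pdR j (b i) x) =
          b i x * (w i * m x ^ (w i - 1) * pdR j m x) by
            rw [pow_succ] at e1; linear_combination e1]
      exact key i j x
    refine (le_of_mul_le_mul_left h4 hp0).trans ?_
    gcongr
    linarith [hwS i]
  · intro x
    have mpx := mp x
    have hmG := mG x
    have hp0 := pow_pos mpx (2 * N)
    have h1 : ∀ i, f i x ^ (2 * p i) ≤ m x ^ (2 * N) * b i x ^ 2 := by
      intro i
      rw [fb, mul_pow, ← pow_mul, show w i * (2 * p i) = 2 * N by rw [← (hp i).2]; ring,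
        mul_comm]
      refine mul_le_mul_of_nonneg_left ?_ hp0.le
      rw [pow_mul]
      obtain ⟨q, hq⟩ : ∃ q, p i = q + 1 := ⟨p i - 1, by have := (hp i).1; omega⟩
      have hb2 : b i x ^ 2 ≤ 1 := by
        rw [← sq_abs]; exact pow_le_one₀ (abs_nonneg _) (b1 i x)
      rw [hq, pow_succ]
      exact mul_le_of_le_one_left (sq_nonneg _) (pow_le_one₀ (sq_nonneg _) hb2)
    have h2 : m x ^ (2 * N) ≤ 1 + m x ^ (2 * N) * ∑ i, b i x ^ 2 := by
      rw [Finset.mul_sum]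
      calc m x ^ (2 * N) = 1 + ∑ i, f i x ^ (2 * p i) := hmG
        _ ≤ _ := by gcongr with i; exact h1 i
    have h3 : m x ^ 2 ≤ m x ^ (2 * N) := pow_le_pow_right₀ (m1 x) (by omega)
    rw [← Finset.sum_mul]
    set s := ∑ i, b i x ^ 2
    have s0 : 0 ≤ s := Finset.sum_nonneg (fun i _ => sq_nonneg _)
    have h5 : m x ^ (2 * N) * m x ^ 4 ≤ m x ^ (2 * N) * (m x ^ 2 + s * m x ^ 4) := by
      have a1 := mul_le_mul_of_nonneg_right h2 (show 0 ≤ m x ^ 4 by positivity)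
      have a2 := mul_le_mul_of_nonneg_right h3 (show 0 ≤ m x ^ 2 by positivity)
      nlinarith
    exact le_of_mul_le_mul_left h5 hp0
  · intro j k x
    exact hBle j k x _ (by have := mp x; positivity) (fun i hi => hBB i hi x)
  · intro x
    obtain ⟨i, hi⟩ := hexU
    obtain ⟨h1, h2⟩ := hU i hi
    rw [← h1]
    exact (le_abs_self _).trans (hBB i h2 x)

end construct

section multi
variable {d : ℕ}

lemma pdIter_contDiff (j : Fin d) (a : ℕ) : ∀ (n : ℕ) {f : Rd d → ℝ}, ContDiff ℝ ((n + a : ℕ)) f →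
    ContDiff ℝ (n : ℕ) (pdIter j a f) := by
  induction a with
  | zero => intro n f hf; simpa [pdIter] using hf
  | succ a ih =>
    intro n f hf
    have h1 : ContDiff ℝ ((n + 1 : ℕ)) (pdIter j a f) :=
      ih (n+1) (by rw [show n + 1 + a = n + (a + 1) by ring]; exact hf)
    exact pdR_contDiff j h1 (by norm_cast)

lemma pdR_pdIter_comm (k j : Fin d) (a : ℕ) {f : Rd d → ℝ} (hf : ContDiff ℝ ((a + 1 : ℕ)) f) :
    pdR k (pdIter j a f) = pdIter j a (pdR k f) := by
  induction a with
  | zero => rfl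
  | succ a ih =>
    have h2 : ContDiff ℝ ((2 : ℕ)) (pdIter j a f) :=
      pdIter_contDiff j a 2 (by rw [show 2 + a = a + 1 + 1 by ring]; exact hf)
    have h3 : pdR k (pdR j (pdIter j a f)) = pdR j (pdR k (pdIter j a f)) :=
      pdR_comm (by exact_mod_cast h2) k j
    simp only [pdIter]
    rw [h3, ih (hf.of_le (by norm_cast; omega))]

/-- The iterated derivative along a list of directions. -/
def pdL (l : List (Fin d)) (α : Fin d → ℕ) (f : Rd d → ℝ) : Rd d → ℝ :=
  l.foldr (fun j g => pdIter j (α j) g) f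

lemma pdL_contDiff (l : List (Fin d)) (α : Fin d → ℕ) : ∀ (n : ℕ) {f : Rd d → ℝ},
    ContDiff ℝ ((n + (l.map α).sum : ℕ)) f → ContDiff ℝ (n : ℕ) (pdL l α f) := by
  induction l with
  | nil => intro n f hf; simpa [pdL] using hf
  | cons j t ih =>
    intro n f hf
    have h1 : ContDiff ℝ ((n + α j : ℕ)) (pdL t α f) := by
      apply ih
      rw [List.map_cons, List.sum_cons, ← add_assoc] at hf
      exact hf
    exact pdIter_contDiff j (α j) n h1

lemma pdL_congr (l : List (Fin d)) {α β : Fin d → ℕ} (h : ∀ j ∈ l, α j = β j) (f : Rd d → ℝ) :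
    pdL l α f = pdL l β f := by
  induction l with
  | nil => rfl
  | cons j t ih =>
    have h1 := ih (fun i hi => h i (List.mem_cons_of_mem _ hi))
    have h2 := h j List.mem_cons_self
    simp only [pdL, List.foldr_cons] at h1 ⊢
    rw [h1, h2]

lemma pdR_pdL (k : Fin d) (l : List (Fin d)) (hl : l.Nodup) (hk : k ∈ l) (α : Fin d → ℕ)
    {f : Rd d → ℝ} (hf : ContDiff ℝ ((1 + (l.map α).sum : ℕ)) f) :
    pdR k (pdL l α f) = pdL l (α + Pi.single k 1) f := by
  induction l with
  | nil => simp at hk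
  | cons j t ih =>
    rw [List.nodup_cons] at hl
    rw [List.map_cons, List.sum_cons, ← add_assoc] at hf
    change pdR k (pdIter j (α j) (pdL t α f)) =
      pdIter j ((α + Pi.single k 1 : Fin d → ℕ) j) (pdL t (α + Pi.single k 1) f)
    by_cases hjk : j = k
    · subst hjk
      have h1 : pdL t (α + Pi.single j 1) f = pdL t α f := by
        apply pdL_congr
        intro i hi
        have : i ≠ j := fun h => hl.1 (h ▸ hi)
        simp [this]
      rw [h1]
      simp [pdIter]
    · have h1 : k ∈ t := by
        rcases List.mem_cons.mp hk with h | h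
        · exact absurd h.symm hjk
        · exact h
      have h2 : ContDiff ℝ ((α j + 1 : ℕ)) (pdL t α f) :=
        pdL_contDiff t α _ (by rw [show α j + 1 = 1 + α j by ring]; exact hf)
      rw [pdR_pdIter_comm k j _ h2, ih hl.2 h1 (hf.of_le (by norm_cast; omega))]
      simp [hjk]

lemma pdMulti_contDiff (α : Fin d → ℕ) (n : ℕ) {f : Rd d → ℝ}
    (hf : ContDiff ℝ ((n + ∑ i, α i : ℕ)) f) : ContDiff ℝ (n : ℕ) (pdMulti α f) :=
  pdL_contDiff (List.finRange d) α n (by rw [← Fin.sum_univ_def]; exact hf)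

lemma pdR_pdMulti (k : Fin d) (α : Fin d → ℕ) {f : Rd d → ℝ}
    (hf : ContDiff ℝ ((1 + ∑ i, α i : ℕ)) f) :
    pdR k (pdMulti α f) = pdMulti (α + Pi.single k 1) f :=
  pdR_pdL k (List.finRange d) (List.nodup_finRange d) (List.mem_finRange k) α
    (by rw [← Fin.sum_univ_def]; exact hf)

lemma pdMulti_zero (f : Rd d → ℝ) : pdMulti 0 f = f := by
  unfold pdMulti
  induction (List.finRange d) with
  | nil => rfl
  | cons j t ih => rw [List.foldr_cons, ih]; rfl

lemma sum_add_single (α : Fin d → ℕ) (k : Fin d) :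
    ∑ i, (α + Pi.single k 1 : Fin d → ℕ) i = (∑ i, α i) + 1 := by
  simp [Finset.sum_add_distrib]

lemma exists_pred (α : Fin d → ℕ) (h : ∑ i, α i ≠ 0) :
    ∃ β : Fin d → ℕ, ∃ k, α = β + Pi.single k 1 := by
  obtain ⟨k, -, hk⟩ := Finset.exists_ne_zero_of_sum_ne_zero h
  refine ⟨Function.update α k (α k - 1), k, ?_⟩
  funext i
  by_cases hi : i = k
  · subst hi; simp; omega
  · simp [hi]

lemma mem_mIdx (q : ℕ) (α : Fin d → ℕ) : α ∈ mIdx d q ↔ ∑ i, α i = q := by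
  unfold mIdx; rw [Finset.Nat.mem_antidiagonalTuple]

end multi

section inst
variable {d : ℕ}

/-- The family of base functions. -/
def Fbase (A : Fin d → Rd d → ℝ) (U : Rd d → ℝ) : Option (Fin d × Fin d) → Rd d → ℝ
  | none => U
  | some jk => magB A jk.1 jk.2

/-- Maximal order. -/
def Rtop (r : ℕ) : Option (Fin d × Fin d) → ℕ
  | none => r + 1
  | some _ => r

/-- Admissible index. -/
def okI : Option (Fin d × Fin d) → Prop
  | none => True
  | some jk => jk.1 < jk.2

/-- The index set. -/
abbrev Idx (d r : ℕ) : Type :=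
  {p : Option (Fin d × Fin d) × (Fin d → ℕ) // okI p.1 ∧ ∑ i, p.2 i ≤ Rtop r p.1}

instance (d r : ℕ) : Finite (Idx d r) := by
  have h : Set.Finite ((Set.univ : Set (Option (Fin d × Fin d))) ×ˢ
      (Set.pi Set.univ (fun _ : Fin d => Set.Iic (r+1)))) :=
    Set.finite_univ.prod (Set.Finite.pi' (fun _ => Set.finite_Iic _) |>.subset (by
      intro x hx i; exact hx i (Set.mem_univ i)))
  refine (h.subset ?_ : Set.Finite {p : Option (Fin d × Fin d) × (Fin d → ℕ) |
    okI p.1 ∧ ∑ i, p.2 i ≤ Rtop r p.1})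
  rintro ⟨o, α⟩ ⟨_, h2⟩
  refine ⟨Set.mem_univ _, fun i _ => ?_⟩
  have h3 : α i ≤ ∑ i, α i := Finset.single_le_sum (fun _ _ => Nat.zero_le _) (Finset.mem_univ i)
  have h4 : Rtop r o ≤ r + 1 := by cases o <;> simp [Rtop]
  exact h3.trans (h2.trans h4)

instance (d r : ℕ) : Fintype (Idx d r) := Fintype.ofFinite _

lemma Fbase_contDiff {r : ℕ} {A : Fin d → Rd d → ℝ} {U : Rd d → ℝ}
    (hA : ∀ j, ContDiff ℝ ((r+2 : ℕ)) (A j)) (hU : ContDiff ℝ ((r+2 : ℕ)) U)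
    (o : Option (Fin d × Fin d)) : ContDiff ℝ ((Rtop r o + 1 : ℕ)) (Fbase A U o) := by
  cases o with
  | none => exact hU
  | some jk =>
    have h : ∀ j k, ContDiff ℝ ((r+1 : ℕ)) (pdR j (A k)) := fun j k =>
      pdR_contDiff j (hA k) (by norm_cast)
    exact (h jk.1 jk.2).sub (h jk.2 jk.1)

lemma g_top_bound {r : ℕ} {A : Fin d → Rd d → ℝ} {U : Rd d → ℝ} {C : ℝ} (hC : 0 < C)
    (hcond : ∀ x : Rd d,
      (∑ jk ∈ Finset.univ.filter (fun jk : Fin d × Fin d => jk.1 < jk.2),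
        ∑ β ∈ mIdx d (r+1), |pdMulti β (magB A jk.1 jk.2) x|)
      + (∑ β ∈ mIdx d (r+2), |pdMulti β U x|)
      ≤ C * ((∑ jk ∈ Finset.univ.filter (fun jk : Fin d × Fin d => jk.1 < jk.2),
          ∑ q ∈ Finset.range (r+1), ∑ β ∈ mIdx d q, |pdMulti β (magB A jk.1 jk.2) x|)
        + (∑ q ∈ Finset.range (r+2), ∑ β ∈ mIdx d q, |pdMulti β U x|) + 1)) :
    ∃ K0 : ℝ, 1 ≤ K0 ∧ ∀ o β x (T : ℝ), okI o → ∑ i, β i = Rtop r o + 1 → 1 ≤ T →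
      (∀ i : Idx d r, |pdMulti i.1.2 (Fbase A U i.1.1) x| ≤ T) →
      |pdMulti β (Fbase A U o) x| ≤ K0 * T := by
  obtain ⟨n, hn⟩ : ∃ n : ℝ, n = (∑ jk ∈ Finset.univ.filter (fun jk : Fin d × Fin d => jk.1 < jk.2),
      ∑ q ∈ Finset.range (r+1), ∑ β ∈ mIdx d q, (1:ℝ))
    + (∑ q ∈ Finset.range (r+2), ∑ β ∈ mIdx d q, (1:ℝ)) + 1 := ⟨_, rfl⟩
  have n0 : 0 ≤ n := by
    rw [hn]
    refine add_nonneg (add_nonneg ?_ ?_) zero_le_one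
    · exact Finset.sum_nonneg (fun _ _ => Finset.sum_nonneg (fun _ _ =>
        Finset.sum_nonneg (fun _ _ => zero_le_one)))
    · exact Finset.sum_nonneg (fun _ _ => Finset.sum_nonneg (fun _ _ => zero_le_one))
  refine ⟨1 + C * n, by nlinarith, fun o β x T ho hβ hT hi => ?_⟩
  have h1 : (∑ jk ∈ Finset.univ.filter (fun jk : Fin d × Fin d => jk.1 < jk.2),
          ∑ q ∈ Finset.range (r+1), ∑ β ∈ mIdx d q, |pdMulti β (magB A jk.1 jk.2) x|)
        + (∑ q ∈ Finset.range (r+2), ∑ β ∈ mIdx d q, |pdMulti β U x|) + 1 ≤ n * T := by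
    rw [hn, add_mul, add_mul, Finset.sum_mul, Finset.sum_mul]
    simp only [Finset.sum_mul]
    refine add_le_add (add_le_add ?_ ?_) (by linarith)
    · refine Finset.sum_le_sum (fun jk hjk => Finset.sum_le_sum (fun q hq =>
        Finset.sum_le_sum (fun γ hγ => ?_)))
      rw [Finset.mem_filter] at hjk
      rw [Finset.mem_range] at hq
      rw [mem_mIdx] at hγ
      rw [one_mul]
      exact hi ⟨(some jk, γ), hjk.2, by simp only [Rtop]; omega⟩
    · refine Finset.sum_le_sum (fun q hq => Finset.sum_le_sum (fun γ hγ => ?_))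
      rw [Finset.mem_range] at hq
      rw [mem_mIdx] at hγ
      rw [one_mul]
      exact hi ⟨(none, γ), trivial, by simp only [Rtop]; omega⟩
  have h2 : C * _ ≤ C * (n * T) := mul_le_mul_of_nonneg_left h1 hC.le
  have h3 := (hcond x).trans h2
  have p1 : 0 ≤ ∑ jk ∈ Finset.univ.filter (fun jk : Fin d × Fin d => jk.1 < jk.2),
        ∑ β ∈ mIdx d (r+1), |pdMulti β (magB A jk.1 jk.2) x| :=
    Finset.sum_nonneg (fun _ _ => Finset.sum_nonneg (fun _ _ => abs_nonneg _))
  have p2 : 0 ≤ ∑ β ∈ mIdx d (r+2), |pdMulti β U x| :=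
    Finset.sum_nonneg (fun _ _ => abs_nonneg _)
  have h4 : |pdMulti β (Fbase A U o) x| ≤ C * (n * T) := by
    cases o with
    | none =>
      have := Finset.single_le_sum (f := fun β => |pdMulti β U x|) (fun _ _ => abs_nonneg _)
        ((mem_mIdx (r+2) β).mpr hβ)
      simp only [Fbase]
      linarith
    | some jk =>
      have a1 := Finset.single_le_sum (f := fun β => |pdMulti β (magB A jk.1 jk.2) x|)
        (fun _ _ => abs_nonneg _) ((mem_mIdx (r+1) β).mpr hβ)
      have hmem : jk ∈ Finset.univ.filter (fun jk : Fin d × Fin d => jk.1 < jk.2) :=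
        Finset.mem_filter.mpr ⟨Finset.mem_univ jk, ho⟩
      have a2 := Finset.single_le_sum
        (f := fun jk : Fin d × Fin d => ∑ β ∈ mIdx d (r+1), |pdMulti β (magB A jk.1 jk.2) x|)
        (fun _ _ => Finset.sum_nonneg (fun _ _ => abs_nonneg _))
        hmem
      simp only [Fbase]
      linarith
  nlinarith

/-- Differentiation step on the index set. -/
def chainI (r : ℕ) (i i' : Idx d r) (j : Fin d) : Prop := i'.1 = (i.1.1, i.1.2 + Pi.single j 1)

/-- Indices of the undifferentiated magnetic field. -/
def isBI (r : ℕ) (i : Idx d r) (j k : Fin d) : Prop := i.1 = (some (j, k), 0)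

/-- The index of the undifferentiated potential. -/
def isUI (r : ℕ) (i : Idx d r) : Prop := i.1 = (none, 0)

lemma reach_all (r : ℕ) : ∀ (n : ℕ) (i : Idx d r), ∑ l, i.1.2 l = n →
    Reach (chainI r) (isBI r) (isUI r) i := by
  intro n
  induction n with
  | zero =>
    rintro ⟨⟨o, α⟩, h1, h2⟩ h
    have hα : α = 0 := by
      funext l
      exact Finset.sum_eq_zero_iff.mp h l (Finset.mem_univ l)
    subst hα
    cases o with
    | none => exact Reach.baseU _ rfl
    | some jk => exact Reach.baseB _ jk.1 jk.2 rfl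
  | succ n ih =>
    rintro ⟨⟨o, α⟩, h1, h2⟩ h
    obtain ⟨β, k, rfl⟩ := exists_pred α (by simp only at h; omega)
    have hs := sum_add_single β k
    simp only at h h1 h2
    have hb : ∑ l, β l ≤ Rtop r o := by omega
    have hr := ih ⟨(o, β), h1, hb⟩ (by simp only; omega)
    exact Reach.step _ _ k hr (show (_, _) = (_, _) from rfl)

end inst
/-- Shen's maximal magnetic estimate:
`∑_{j,ℓ} ‖(D_j - A_j)(D_ℓ - A_ℓ)u‖ ≤ C'(‖P_{A,U}u‖ + ‖u‖)`. -/
theorem statement_7 (d r : ℕ) (hd : 3 ≤ d)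
    (A : Fin d → Rd d → ℝ) (U : Rd d → ℝ)
    (hA : ∀ j, ContDiff ℝ ((r+2 : ℕ) : ℕ∞) (A j)) (hU : ContDiff ℝ ((r+2 : ℕ) : ℕ∞) U)
    (hUpos : ∀ x, 0 ≤ U x)
    (C : ℝ) (hC : 0 < C)
    (hcond : ∀ x : Rd d,
      (∑ jk ∈ Finset.univ.filter (fun jk : Fin d × Fin d => jk.1 < jk.2),
        ∑ β ∈ mIdx d (r+1), |pdMulti β (magB A jk.1 jk.2) x|)
      + (∑ β ∈ mIdx d (r+2), |pdMulti β U x|)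
      ≤ C * ((∑ jk ∈ Finset.univ.filter (fun jk : Fin d × Fin d => jk.1 < jk.2),
          ∑ q ∈ Finset.range (r+1), ∑ β ∈ mIdx d q, |pdMulti β (magB A jk.1 jk.2) x|)
        + (∑ q ∈ Finset.range (r+2), ∑ β ∈ mIdx d q, |pdMulti β U x|) + 1)) :
    ∃ C' > 0, ∀ u : Rd d → ℂ, ContDiff ℝ (⊤ : ℕ∞) u → HasCompactSupport u →
      (∑ j, ∑ ℓ, Real.sqrt (∫ x : Rd d, ‖Xop A j (Xop A ℓ u) x‖^2))
        ≤ C' * (Real.sqrt (∫ x : Rd d,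
              ‖(∑ j, Xop A j (Xop A j u) x) + (U x : ℂ) * u x‖^2)
            + Real.sqrt (∫ x : Rd d, ‖u x‖^2)) := by
  have hA' : ∀ j, ContDiff ℝ ((r+2 : ℕ)) (A j) := fun j => by exact_mod_cast hA j
  have hU' : ContDiff ℝ ((r+2 : ℕ)) U := by exact_mod_cast hU
  have hF := Fbase_contDiff hA' hU'
  obtain ⟨K0, hK0, htop⟩ := g_top_bound hC hcond
  have hRle : ∀ o : Option (Fin d × Fin d), r ≤ Rtop r o ∧ Rtop r o ≤ r + 1 := by
    intro o; cases o <;> simp [Rtop]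
  have hder : ∀ (i : Idx d r) k, pdR k (pdMulti i.1.2 (Fbase A U i.1.1)) =
      pdMulti (i.1.2 + Pi.single k 1) (Fbase A U i.1.1) := fun i k =>
    pdR_pdMulti k i.1.2 ((hF i.1.1).of_le (by have := i.2.2; norm_cast; omega))
  obtain ⟨K, hK, hP⟩ := pkg_exists (A := A) (U := U) (chainI r) (isBI r) (isUI r)
    (fun i => pdMulti i.1.2 (Fbase A U i.1.1))
    (fun i => by
      have := pdMulti_contDiff i.1.2 1
        ((hF i.1.1).of_le (by have := i.2.2; norm_cast; omega))
      exact_mod_cast this)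
    (fun i => (∑ l, i.1.2 l) + 2) (fun i => by omega) (K0 := K0) (by linarith)
    (by
      intro i k x μ M hμ hM hi
      simp only [hder]
      have hs := sum_add_single i.1.2 k
      by_cases h : (∑ l, i.1.2 l) + 1 ≤ Rtop r i.1.1
      · have h1 := hi ⟨(i.1.1, i.1.2 + Pi.single k 1), i.2.1, by simp only; omega⟩
        simp only [hs] at h1
        have h2 : (0:ℝ) ≤ μ * M ^ ((∑ l, i.1.2 l) + 2 + 1) := by positivity
        rw [show (∑ l, i.1.2 l) + 1 + 2 = (∑ l, i.1.2 l) + 2 + 1 by ring] at h1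
        nlinarith
      · have hle := i.2.2
        have hR := hRle i.1.1
        have hM0 : (0:ℝ) ≤ M := by linarith
        have hone : ∀ n : ℕ, 1 ≤ M ^ n := fun n => one_le_pow₀ hM
        refine (htop i.1.1 _ x (μ * M ^ (r + 3)) i.2.1 (by omega)
          (by nlinarith [hone (r+3)]) (fun i' => (hi i').trans ?_)).trans ?_
        · have h1 := hRle i'.1.1
          have h2 := i'.2.2
          have h3 := pow_le_pow_right₀ hM (show (∑ l, i'.1.2 l) + 2 ≤ r + 3 by omega)
          exact mul_le_mul_of_nonneg_left h3 (by linarith)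
        · have h3 := pow_le_pow_right₀ hM (show r + 3 ≤ (∑ l, i.1.2 l) + 2 + 1 by omega)
          exact mul_le_mul_of_nonneg_left (mul_le_mul_of_nonneg_left h3 (by linarith))
            (by linarith))
    (by
      intro i i' j h
      have h' : i'.1 = (i.1.1, i.1.2 + Pi.single j 1) := h
      simp only [hder]
      rw [h']
      refine ⟨rfl, ?_⟩
      have hs := sum_add_single i.1.2 j
      simp only [hs])
    (by
      intro i j k h
      have h' : i.1 = (some (j, k), 0) := h
      simp only [h', pdMulti_zero]
      refine ⟨rfl, by simp⟩)
    (by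
      intro i h
      have h' : i.1 = (none, 0) := h
      simp only [h', pdMulti_zero]
      refine ⟨rfl, by simp⟩)
    (by
      intro j k x M hM hi
      have hlt : ∀ j k : Fin d, j < k → |magB A j k x| ≤ M := by
        intro j k hjk
        have := hi ⟨(some (j, k), 0), hjk, by simp⟩ (by simp)
        simpa only [pdMulti_zero, Fbase] using this
      rcases lt_trichotomy j k with h | h | h
      · exact hlt j k h
      · subst h; simpa [magB] using hM
      · have h1 := hlt k j h
        have h2 : magB A j k x = -magB A k j x := by simp [magB]
        rw [h2, abs_neg]; exact h1)
    ⟨⟨(none, 0), trivial, by simp⟩, rfl⟩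
  exact core_main (chain := chainI r) (isB := isBI r) (isU := isUI r)
    (fun j => (hA' j).of_le (by norm_cast; omega)) hU'.continuous hUpos hK
    (fun i => reach_all r _ i rfl) hP


end
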